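/- arXiv:1002.4364 — 2 statements merged into one kernel-verified Lean document; each statement's English description precedes it below -/
import Mathlib

section
/- For every integer n ≥ 6 and every integer k with 0 ≤ k ≤ ⌊n/3⌋ − 1, there exists a set P of n points in ℝ² in general position that has exactly one order-k Delaunay triangulation (namely, its Delaunay triangulation). -/
open EuclideanGeometry Set

noncomputable section

/-- Points of the Euclidean plane. -/
abbrev Pt : Type := EuclideanSpace ℝ (Fin 2)

noncomputable instance : DecidableEq Pt := Classical.decEq _

/-- `P` is in general position: no three (distinct) points collinear and
no four (distinct) points concyclic. -/
def GenPos (P : Set Pt) : Prop :=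
  (∀ u v w : Pt, u ∈ P → v ∈ P → w ∈ P → u ≠ v → u ≠ w → v ≠ w →
    ¬ Collinear ℝ ({u, v, w} : Set Pt)) ∧
  (∀ u v w z : Pt, u ∈ P → v ∈ P → w ∈ P → z ∈ P →
    u ≠ v → u ≠ w → u ≠ z → v ≠ w → v ≠ z → w ≠ z →
    ¬ EuclideanGeometry.Cospherical ({u, v, w, z} : Set Pt))

/-- The (closed) triangle spanned by a finite set of points. -/
def triSet (t : Finset Pt) : Set Pt := convexHull ℝ (t : Set Pt)

/-- `T` is a triangulation of `P`: a finite set of triangles with vertices in `P`,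
every point of `P` is a vertex of some triangle, the interiors of the triangles are
pairwise disjoint, and their union is the convex hull of `P`. -/
def IsTriangulation (P : Set Pt) (T : Set (Finset Pt)) : Prop :=
  T.Finite ∧
  (∀ t ∈ T, t.card = 3 ∧ (t : Set Pt) ⊆ P) ∧
  (∀ p ∈ P, ∃ t ∈ T, p ∈ t) ∧
  (T.Pairwise fun t s => interior (triSet t) ∩ interior (triSet s) = ∅) ∧
  (⋃ t ∈ T, triSet t) = convexHull ℝ P

/-- The triangle `t` (with vertex set `t`) is order-`k` Delaunay with respect to `P`:
the open disk bounded by its circumcircle contains at most `k` points of `P`. -/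
def OrderKTri (P : Set Pt) (k : ℕ) (t : Finset Pt) : Prop :=
  ∃ z : Pt, ∃ r : ℝ, (∀ p ∈ t, dist p z = r) ∧ {p ∈ P | dist p z < r}.encard ≤ (k : ℕ∞)

/-- `T` is an order-`k` Delaunay triangulation of `P`. -/
def IsOrderDT (P : Set Pt) (k : ℕ) (T : Set (Finset Pt)) : Prop :=
  IsTriangulation P T ∧ ∀ t ∈ T, OrderKTri P k t

/-- `{u, v}` is an order-`k` Delaunay edge of `P`: some open disk having `u` and `v`
on its boundary circle contains at most `k` points of `P`. -/
def OrderKEdge (P : Set Pt) (k : ℕ) (u v : Pt) : Prop :=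
  ∃ z : Pt, ∃ r : ℝ, dist u z = r ∧ dist v z = r ∧ {p ∈ P | dist p z < r}.encard ≤ (k : ℕ∞)

/-- `{u, v}` is a useful order-`k` Delaunay edge of `P`: some order-`k` Delaunay
triangulation of `P` contains a triangle having `u` and `v` among its vertices
(i.e. having segment `uv` as a side). -/
def UsefulEdge (P : Set Pt) (k : ℕ) (u v : Pt) : Prop :=
  ∃ T, IsOrderDT P k T ∧ ∃ t ∈ T, u ∈ t ∧ v ∈ t

/-- `{u, v}` is a Delaunay edge: it is an edge of the (unique) order-0 Delaunay
triangulation of `P`. -/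
def DelaunayEdge (P : Set Pt) (u v : Pt) : Prop := UsefulEdge P 0 u v

/-- `p` lies strictly to the left of the directed line from `v` to `u`, i.e. the
triple `v, u, p` makes a counterclockwise turn. -/
def ccw (v u p : Pt) : Prop :=
  0 < (u 0 - v 0) * (p 1 - v 1) - (u 1 - v 1) * (p 0 - v 0)


/-- Twice the signed area of the triangle `a b c`. -/
def sArea (a b c : Pt) : ℝ :=
  (b 0 - a 0) * (c 1 - a 1) - (b 1 - a 1) * (c 0 - a 0)

/-- The squared Euclidean norm, in coordinates. -/
def sqNorm (a : Pt) : ℝ := a 0 ^ 2 + a 1 ^ 2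

/-- The in-circle determinant: for a counterclockwise triangle `a b c` it is negative exactly when
`d` lies in the open circumdisk. -/
def inCirc (a b c d : Pt) : ℝ :=
  sqNorm d * sArea a b c - sqNorm a * sArea b c d + sqNorm b * sArea a c d - sqNorm c * sArea a b d

lemma sArea_rot (a b c : Pt) : sArea b c a = sArea a b c := by
  unfold sArea; ring

lemma sArea_swap (a b c : Pt) : sArea b a c = -sArea a b c := by
  unfold sArea; ring

lemma sArea_swap_right (a b c : Pt) : sArea a c b = -sArea a b c := by
  unfold sArea; ring

lemma sArea_self_left (a b : Pt) : sArea a b a = 0 := by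
  unfold sArea; ring

lemma sArea_self_right (a b : Pt) : sArea a b b = 0 := by
  unfold sArea; ring

lemma inCirc_swap₃₄ (a b c d : Pt) : inCirc a b d c = -inCirc a b c d := by
  unfold inCirc sArea; ring

lemma inCirc_cycle (a b c d : Pt) : inCirc b c d a = -inCirc a b c d := by
  unfold inCirc sArea; ring

lemma inCirc_rot (a b c d : Pt) : inCirc b c a d = inCirc a b c d := by
  unfold inCirc sArea; ring

lemma inCirc_swap_pairs (a b c d : Pt) : inCirc c d a b = inCirc a b c d := by
  unfold inCirc sArea; ring

lemma inCirc_self₁ (a b c : Pt) : inCirc a b c a = 0 := by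
  unfold inCirc sArea; ring

lemma inCirc_self₂ (a b c : Pt) : inCirc a b c b = 0 := by
  unfold inCirc sArea; ring

lemma inCirc_self₃ (a b c : Pt) : inCirc a b c c = 0 := by
  unfold inCirc sArea; ring

lemma ne_of_sArea_ne_zero {a b c : Pt} (h : sArea a b c ≠ 0) : a ≠ b ∧ b ≠ c ∧ a ≠ c := by
  refine ⟨?_, ?_, ?_⟩ <;> rintro rfl <;> apply h <;> unfold sArea <;> ring

lemma collinear_of_sArea_eq_zero {a b c : Pt} (hab : a ≠ b) (h : sArea a b c = 0) :
    Collinear ℝ ({a, b, c} : Set Pt) := by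
  have hpos : 0 < (b 0 - a 0) ^ 2 + (b 1 - a 1) ^ 2 := by
    by_contra! hle
    have h0 : b 0 - a 0 = 0 := by nlinarith [sq_nonneg (b 0 - a 0), sq_nonneg (b 1 - a 1)]
    have h1 : b 1 - a 1 = 0 := by nlinarith [sq_nonneg (b 0 - a 0), sq_nonneg (b 1 - a 1)]
    refine hab (PiLp.ext fun i => ?_)
    fin_cases i
    · exact (sub_eq_zero.1 h0).symm
    · exact (sub_eq_zero.1 h1).symm
  rw [collinear_iff_of_mem (p₀ := a) (by simp)]
  refine ⟨b - a, ?_⟩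
  rintro x (rfl | rfl | rfl)
  · exact ⟨0, by simp⟩
  · exact ⟨1, by simp⟩
  · refine ⟨((b 0 - a 0) * (x 0 - a 0) + (b 1 - a 1) * (x 1 - a 1)) /
      ((b 0 - a 0) ^ 2 + (b 1 - a 1) ^ 2), ?_⟩
    unfold sArea at h
    ext i
    fin_cases i
    · simp only [Fin.zero_eta, vadd_eq_add, PiLp.add_apply, PiLp.smul_apply, PiLp.sub_apply,
        smul_eq_mul]
      field_simp
      linear_combination -(b 1 - a 1) * h
    · simp only [Fin.mk_one, vadd_eq_add, PiLp.add_apply, PiLp.smul_apply, PiLp.sub_apply,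
        smul_eq_mul]
      field_simp
      linear_combination (b 0 - a 0) * h

lemma dist_sq_coord (a z : Pt) : dist a z ^ 2 = (a 0 - z 0) ^ 2 + (a 1 - z 1) ^ 2 := by
  rw [EuclideanSpace.dist_eq, Real.sq_sqrt (by positivity), Fin.sum_univ_two, Real.dist_eq,
    Real.dist_eq, sq_abs, sq_abs]

lemma dist_sq_sub_mul_sArea {a b c z : Pt} {r : ℝ} (ha : dist a z = r) (hb : dist b z = r)
    (hc : dist c z = r) (d : Pt) : (dist d z ^ 2 - r ^ 2) * sArea a b c = inCirc a b c d := by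
  have h1 := dist_sq_coord a z
  have h2 := dist_sq_coord b z
  have h3 := dist_sq_coord c z
  rw [ha] at h1
  rw [hb] at h2
  rw [hc] at h3
  rw [dist_sq_coord d z]
  unfold inCirc sqNorm sArea
  linear_combination (-((c 0 - b 0) * (d 1 - b 1) - (c 1 - b 1) * (d 0 - b 0))) * h1
    + ((c 0 - a 0) * (d 1 - a 1) - (c 1 - a 1) * (d 0 - a 0)) * h2
    - ((b 0 - a 0) * (d 1 - a 1) - (b 1 - a 1) * (d 0 - a 0)) * h3

lemma dist_lt_of_mul_neg {a b c z : Pt} {r : ℝ} (ha : dist a z = r) (hb : dist b z = r)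
    (hc : dist c z = r) {d : Pt} (h : sArea a b c * inCirc a b c d < 0) : dist d z < r := by
  rw [← dist_sq_sub_mul_sArea ha hb hc d] at h
  have hr : 0 ≤ r := ha ▸ dist_nonneg
  by_contra! hd
  have : r ^ 2 ≤ dist d z ^ 2 := by gcongr
  nlinarith [mul_nonneg (sub_nonneg.2 this) (sq_nonneg (sArea a b c))]

lemma le_dist_of_nonneg {a b c z : Pt} {r : ℝ} (ha : dist a z = r) (hb : dist b z = r)
    (hc : dist c z = r) {d : Pt} (hD : 0 < sArea a b c) (h : 0 ≤ inCirc a b c d) :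
    r ≤ dist d z := by
  rw [← dist_sq_sub_mul_sArea ha hb hc d] at h
  have h2 : 0 ≤ dist d z ^ 2 - r ^ 2 := nonneg_of_mul_nonneg_left h hD
  exact le_of_sq_le_sq (by linarith) dist_nonneg

lemma not_collinear_of_sArea_ne_zero {a b c : Pt} (h : sArea a b c ≠ 0) :
    ¬ Collinear ℝ ({a, b, c} : Set Pt) := by
  intro hcol
  obtain ⟨v, hv⟩ := (collinear_iff_of_mem (p₀ := a) (by simp)).1 hcol
  obtain ⟨r, hr⟩ := hv b (by simp)
  obtain ⟨s, hs⟩ := hv c (by simp)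
  apply h
  subst hr hs
  simp [sArea]
  ring

lemma not_cospherical_of_inCirc_ne_zero {a b c d : Pt} (h : inCirc a b c d ≠ 0) :
    ¬ EuclideanGeometry.Cospherical ({a, b, c, d} : Set Pt) := by
  rintro ⟨z, r, hz⟩
  apply h
  rw [← dist_sq_sub_mul_sArea (hz a (by simp)) (hz b (by simp)) (hz c (by simp)) d,
    hz d (by simp)]
  ring

lemma exists_circumcircle {a b c : Pt} (h : sArea a b c ≠ 0) :
    ∃ z : Pt, ∃ r : ℝ, dist a z = r ∧ dist b z = r ∧ dist c z = r := by
  let z : Pt := !₂[((sqNorm b - sqNorm a) * (c 1 - a 1) - (sqNorm c - sqNorm a) * (b 1 - a 1)) /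
      (2 * sArea a b c),
    ((b 0 - a 0) * (sqNorm c - sqNorm a) - (c 0 - a 0) * (sqNorm b - sqNorm a)) /
      (2 * sArea a b c)]
  have h0 : z 0 * (2 * sArea a b c) =
      (sqNorm b - sqNorm a) * (c 1 - a 1) - (sqNorm c - sqNorm a) * (b 1 - a 1) :=
    div_mul_cancel₀ _ (by simpa using h)
  have h1 : z 1 * (2 * sArea a b c) =
      (b 0 - a 0) * (sqNorm c - sqNorm a) - (c 0 - a 0) * (sqNorm b - sqNorm a) :=
    div_mul_cancel₀ _ (by simpa using h)
  refine ⟨z, dist a z, rfl, ?_, ?_⟩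
  · rw [← sq_eq_sq₀ dist_nonneg dist_nonneg, dist_sq_coord, dist_sq_coord]
    apply mul_right_cancel₀ h
    unfold sqNorm sArea at *
    linear_combination (-(b 0 - a 0)) * h0 - (b 1 - a 1) * h1
  · rw [← sq_eq_sq₀ dist_nonneg dist_nonneg, dist_sq_coord, dist_sq_coord]
    apply mul_right_cancel₀ h
    unfold sqNorm sArea at *
    linear_combination (-(c 0 - a 0)) * h0 - (c 1 - a 1) * h1

lemma not_orderKTri {P : Set Pt} {k : ℕ} {t : Finset Pt} {a b c : Pt} (ha : a ∈ t) (hb : b ∈ t)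
    (hc : c ∈ t) (s : Finset Pt) (hs : (s : Set Pt) ⊆ P) (hk : k < s.card)
    (h : ∀ x ∈ s, sArea a b c * inCirc a b c x < 0) : ¬ OrderKTri P k t := by
  rintro ⟨z, r, hz, hcard⟩
  have hsub : (s : Set Pt) ⊆ {p ∈ P | dist p z < r} := fun x hx =>
    ⟨hs hx, dist_lt_of_mul_neg (hz a ha) (hz b hb) (hz c hc) (h x hx)⟩
  have := (Set.encard_le_encard hsub).trans hcard
  rw [Set.encard_coe_eq_coe_finsetCard] at this
  exact absurd (by exact_mod_cast this) (not_le.2 hk)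

lemma orderKTri_of_inCirc_nonneg {P : Set Pt} {k : ℕ} {a b c : Pt} (h : 0 < sArea a b c)
    (hP : ∀ x ∈ P, 0 ≤ inCirc a b c x) : OrderKTri P k {a, b, c} := by
  obtain ⟨z, r, ha, hb, hc⟩ := exists_circumcircle h.ne'
  refine ⟨z, r, by simp [ha, hb, hc], ?_⟩
  have : {p ∈ P | dist p z < r} = ∅ := by
    ext x
    simp only [mem_ofPred_eq, mem_empty_iff_false, iff_false, not_and, not_lt]
    exact fun hx => le_dist_of_nonneg ha hb hc h (hP x hx)
  simp [this]

/-- A point of a triangle in terms of its barycentric coordinates. -/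
lemma mem_convexHull_of_sArea_nonneg {a b c x : Pt} (h : 0 < sArea a b c)
    (h1 : 0 ≤ sArea a b x) (h2 : 0 ≤ sArea b c x) (h3 : 0 ≤ sArea c a x) :
    x ∈ convexHull ℝ ({a, b, c} : Set Pt) := by
  have hsum : sArea b c x + sArea c a x + sArea a b x = sArea a b c := by
    unfold sArea; ring
  have hx : x = (sArea b c x / sArea a b c) • a + (sArea c a x / sArea a b c) • b
      + (sArea a b x / sArea a b c) • c := by
    ext i
    simp only [PiLp.add_apply, PiLp.smul_apply, smul_eq_mul]
    field_simp
    fin_cases i <;> simp [sArea] <;> ring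
  rw [hx]
  have hm : ∀ y ∈ ({a, b, c} : Set Pt), y ∈ convexHull ℝ ({a, b, c} : Set Pt) :=
    fun y hy => subset_convexHull ℝ _ hy
  have := (convex_convexHull ℝ ({a, b, c} : Set Pt)).sum_mem (t := Finset.univ)
    (w := ![sArea b c x / sArea a b c, sArea c a x / sArea a b c, sArea a b x / sArea a b c])
    (z := ![a, b, c])
    (by intro i _; fin_cases i <;> simp <;> positivity)
    (by simp [Fin.sum_univ_three]; field_simp; linarith)
    (by intro i _; apply hm; fin_cases i <;> simp)
  simpa [Fin.sum_univ_three] using this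

lemma sArea_combo (a b x y : Pt) {u v : ℝ} (h : u + v = 1) :
    sArea a b (u • x + v • y) = u * sArea a b x + v * sArea a b y := by
  simp only [sArea, PiLp.add_apply, PiLp.smul_apply, smul_eq_mul]
  linear_combination ((b 0 - a 0) * a 1 - (b 1 - a 1) * a 0) * h

lemma convex_sArea_nonneg (a b : Pt) : Convex ℝ {x : Pt | 0 ≤ sArea a b x} := by
  intro x hx y hy u v hu hv huv
  simp only [mem_ofPred_eq] at *
  rw [sArea_combo a b x y huv]
  positivity

lemma sArea_nonneg_of_mem_convexHull {S : Set Pt} {a b x : Pt} (h : ∀ p ∈ S, 0 ≤ sArea a b p)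
    (hx : x ∈ convexHull ℝ S) : 0 ≤ sArea a b x :=
  convexHull_min (t := {x : Pt | 0 ≤ sArea a b x}) h (convex_sArea_nonneg a b) hx

lemma sArea_nonpos_of_mem_convexHull {S : Set Pt} {a b x : Pt} (h : ∀ p ∈ S, sArea a b p ≤ 0)
    (hx : x ∈ convexHull ℝ S) : sArea a b x ≤ 0 := by
  have := sArea_nonneg_of_mem_convexHull (S := S) (a := b) (b := a) (x := x)
    (fun p hp => by rw [sArea_swap]; linarith [h p hp]) hx
  rw [sArea_swap] at this
  linarith

lemma continuous_sArea (a b : Pt) : Continuous (sArea a b) := by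
  unfold sArea; fun_prop

lemma mem_interior_triSet {a b c x : Pt} (h : 0 < sArea a b c)
    (h1 : 0 < sArea a b x) (h2 : 0 < sArea b c x) (h3 : 0 < sArea c a x) :
    x ∈ interior (triSet {a, b, c}) := by
  rw [mem_interior]
  refine ⟨{y | 0 < sArea a b y} ∩ {y | 0 < sArea b c y} ∩ {y | 0 < sArea c a y}, ?_, ?_,
    ⟨⟨h1, h2⟩, h3⟩⟩
  · rintro y ⟨⟨hy1, hy2⟩, hy3⟩
    simpa [triSet] using mem_convexHull_of_sArea_nonneg h hy1.le hy2.le hy3.le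
  · exact ((isOpen_lt continuous_const (continuous_sArea a b)).inter
      (isOpen_lt continuous_const (continuous_sArea b c))).inter
      (isOpen_lt continuous_const (continuous_sArea c a))

lemma triSet_interior_nonempty {a b c : Pt} (h : sArea a b c ≠ 0) :
    (interior (triSet {a, b, c})).Nonempty := by
  wlog hpos : 0 < sArea a b c generalizing a b
  · have hba : 0 < sArea b a c := by
      rw [sArea_swap]; linarith [lt_of_le_of_ne (not_lt.1 hpos) h]
    rw [Finset.insert_comm]
    exact this hba.ne' hba
  have key : ∀ u v w : Pt, sArea u v w = sArea a b c →
      ∀ x : Pt, x = (1 / 3 : ℝ) • u + (1 / 3 : ℝ) • v + (1 / 3 : ℝ) • w → 0 < sArea u v x := by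
    rintro u v w huv x rfl
    have : sArea u v ((1 / 3 : ℝ) • u + (1 / 3 : ℝ) • v + (1 / 3 : ℝ) • w) =
        1 / 3 * sArea u v w := by
      simp [sArea]; ring
    rw [this, huv]; positivity
  refine ⟨(1 / 3 : ℝ) • a + (1 / 3 : ℝ) • b + (1 / 3 : ℝ) • c, mem_interior_triSet hpos ?_ ?_ ?_⟩
  · exact key a b c rfl _ rfl
  · exact key b c a (sArea_rot a b c) _ (by abel)
  · exact key c a b (by rw [sArea_rot, sArea_rot]) _ (by abel)

lemma interior_disjoint_of_separated {t s : Finset Pt} {a b : Pt} (hab : a ≠ b)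
    (ht : ∀ x ∈ t, sArea a b x ≤ 0) (hs : ∀ x ∈ s, 0 ≤ sArea a b x) :
    interior (triSet t) ∩ interior (triSet s) = ∅ := by
  rw [Set.eq_empty_iff_forall_notMem]
  rintro x ⟨hxt, hxs⟩
  have h1 : 0 ≤ sArea a b x := sArea_nonneg_of_mem_convexHull hs (interior_subset hxs)
  let n : Pt := !₂[-(b 1 - a 1), b 0 - a 0]
  have hn : ∀ ε : ℝ, sArea a b (x + ε • n) = sArea a b x + ε * dist a b ^ 2 := by
    intro ε
    rw [dist_sq_coord]
    simp [sArea, n]; ring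
  have hcont : Filter.Tendsto (fun ε : ℝ => x + ε • n) (nhdsWithin 0 (Ioi 0)) (nhds x) := by
    have : Continuous (fun ε : ℝ => x + ε • n) := by fun_prop
    have h := this.tendsto 0
    simp only [zero_smul, add_zero] at h
    exact h.mono_left nhdsWithin_le_nhds
  have hev := hcont.eventually (isOpen_interior.mem_nhds hxt)
  obtain ⟨ε, hε, hpos⟩ := (hev.and self_mem_nhdsWithin).exists
  have h2 := sArea_nonpos_of_mem_convexHull ht (interior_subset hε)
  rw [hn] at h2
  have : 0 < dist a b := dist_pos.2 hab
  have : 0 < ε * dist a b ^ 2 := mul_pos hpos (by positivity)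
  linarith

/-- Two triangles with a common apex `v` overlap if an edge of one points into the angle of the
other. -/
lemma interior_inter_nonempty_of_cone {v p q a x : Pt} (hs : 0 < sArea v p q)
    (h1 : 0 < sArea v p a) (h2 : 0 < sArea v a q) (ht : sArea v a x ≠ 0) :
    (interior (triSet {v, p, q}) ∩ interior (triSet {v, a, x})).Nonempty := by
  have hcont : Filter.Tendsto (fun ε : ℝ => (1 - ε) • v + ε • a) (nhdsWithin 0 (Ioi 0))
      (nhds v) := by
    have : Continuous (fun ε : ℝ => (1 - ε) • v + ε • a) := by fun_prop
    have h := this.tendsto 0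
    simp only [zero_smul, add_zero, sub_zero, one_smul] at h
    exact h.mono_left nhdsWithin_le_nhds
  have hpq : 0 < sArea p q v := by rwa [sArea_rot]
  have hev := hcont.eventually
    ((isOpen_lt continuous_const (continuous_sArea p q)).mem_nhds hpq)
  have hle : ∀ᶠ ε : ℝ in nhdsWithin 0 (Ioi 0), ε ≤ 1 :=
    Filter.Eventually.filter_mono nhdsWithin_le_nhds (eventually_le_nhds zero_lt_one)
  obtain ⟨ε, ⟨h3, hε1⟩, hε⟩ := ((hev.and hle).and self_mem_nhdsWithin).exists
  have hε0 : 0 < ε := hε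
  set y := (1 - ε) • v + ε • a with hy
  have hy1 : 0 < sArea v p y := by
    rw [hy, sArea_combo _ _ _ _ (by ring), sArea_self_left]
    simpa using mul_pos hε0 h1
  have hy2 : 0 < sArea q v y := by
    rw [hy, sArea_combo _ _ _ _ (by ring), sArea_self_right, ← sArea_rot]
    simpa using mul_pos hε0 h2
  have hyS : y ∈ interior (triSet {v, p, q}) := mem_interior_triSet hs hy1 h3 hy2
  have hyT : y ∈ triSet {v, a, x} :=
    (convex_convexHull ℝ _) (subset_convexHull ℝ _ (by simp)) (subset_convexHull ℝ _ (by simp))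
      (by linarith) hε0.le (by ring)
  have hcl : y ∈ closure (interior (triSet {v, a, x})) := by
    have hconv : Convex ℝ (triSet {v, a, x}) := convex_convexHull ℝ _
    rw [hconv.closure_interior_eq_closure_of_nonempty_interior (triSet_interior_nonempty ht)]
    exact subset_closure hyT
  exact mem_closure_iff.1 hcl _ isOpen_interior hyS

lemma triangulation_eq_of_subset {P : Set Pt} {T T' : Set (Finset Pt)} (hT : IsTriangulation P T)
    (hT' : IsTriangulation P T') (hne : ∀ t ∈ T, (interior (triSet t)).Nonempty) (h : T' ⊆ T) :
    T' = T := by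
  refine h.antisymm fun t ht => ?_
  by_contra htT'
  obtain ⟨x, hx⟩ := hne t ht
  have hxP : x ∈ ⋃ s ∈ T', triSet s := by
    rw [hT'.2.2.2.2, ← hT.2.2.2.2]
    exact mem_biUnion ht (interior_subset hx)
  simp only [mem_iUnion] at hxP
  obtain ⟨s, hs, hxs⟩ := hxP
  have hst : s ≠ t := fun e => htT' (e ▸ hs)
  have hdis := hT.2.2.2.1 (h hs) ht hst
  have hcl : x ∈ closure (interior (triSet s)) := by
    have hconv : Convex ℝ (triSet s) := convex_convexHull ℝ _
    rw [hconv.closure_interior_eq_closure_of_nonempty_interior (hne s (h hs))]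
    exact subset_closure hxs
  obtain ⟨y, hy⟩ := mem_closure_iff.1 hcl _ isOpen_interior hx
  exact (Set.eq_empty_iff_forall_notMem.1 hdis) y ⟨hy.2, hy.1⟩

/-- A hull edge is a side of some triangle of every triangulation. -/
lemma exists_triangle_of_hull_edge {P : Set Pt} {T : Set (Finset Pt)} (hT : IsTriangulation P T)
    {a b : Pt} (ha : a ∈ P) (hb : b ∈ P) (h : ∀ x ∈ P, x ≠ a → x ≠ b → 0 < sArea a b x) :
    ∃ t ∈ T, a ∈ t ∧ b ∈ t := by
  by_cases hab : a = b
  · subst hab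
    obtain ⟨t, ht, hat⟩ := hT.2.2.1 a ha
    exact ⟨t, ht, hat, hat⟩
  have hm : midpoint ℝ a b ∈ ⋃ t ∈ T, triSet t := by
    rw [hT.2.2.2.2]
    exact (convex_convexHull ℝ P).midpoint_mem (subset_convexHull ℝ _ ha)
      (subset_convexHull ℝ _ hb)
  simp only [mem_iUnion] at hm
  obtain ⟨t, ht, hmt⟩ := hm
  refine ⟨t, ht, ?_⟩
  have hP := (hT.2.1 t ht).2
  rw [triSet, Finset.mem_convexHull'] at hmt
  obtain ⟨w, hw0, hw1, hwm⟩ := hmt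
  have hnn : ∀ x ∈ t, 0 ≤ sArea a b x := fun x hx => by
    by_cases hxa : x = a
    · rw [hxa, sArea_self_left]
    by_cases hxb : x = b
    · rw [hxb, sArea_self_right]
    exact (h x (hP hx) hxa hxb).le
  have c0 : ∑ x ∈ t, w x * x 0 = (a 0 + b 0) / 2 := by
    have := congrArg (fun x : Pt => x 0) hwm
    simp [midpoint_eq_smul_add] at this
    rw [this]; ring
  have c1 : ∑ x ∈ t, w x * x 1 = (a 1 + b 1) / 2 := by
    have := congrArg (fun x : Pt => x 1) hwm
    simp [midpoint_eq_smul_add] at this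
    rw [this]; ring
  have hsum : ∑ x ∈ t, w x * sArea a b x = 0 := by
    have : ∀ x ∈ t, w x * sArea a b x = (b 0 - a 0) * (w x * x 1) - (b 1 - a 1) * (w x * x 0)
        + ((b 1 - a 1) * a 0 - (b 0 - a 0) * a 1) * w x := fun x _ => by unfold sArea; ring
    rw [Finset.sum_congr rfl this, Finset.sum_add_distrib, Finset.sum_sub_distrib,
      ← Finset.mul_sum, ← Finset.mul_sum, ← Finset.mul_sum, c0, c1, hw1]
    ring
  have hz := (Finset.sum_eq_zero_iff_of_nonneg
    (fun x hx => mul_nonneg (hw0 x hx) (hnn x hx))).1 hsum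
  have hzero : ∀ x ∈ t, x ≠ a → x ≠ b → w x = 0 := fun x hx hxa hxb =>
    (mul_eq_zero.1 (hz x hx)).resolve_right (h x (hP hx) hxa hxb).ne'
  have hmid : ∀ u : Pt, (∀ x ∈ t, x ≠ u → w x = 0) → midpoint ℝ a b = u := by
    intro u hu
    rw [← hwm]
    have : ∀ x ∈ t, w x • x = w x • u := fun x hx => by
      by_cases hxu : x = u
      · rw [hxu]
      · rw [hu x hx hxu, zero_smul, zero_smul]
    rw [Finset.sum_congr rfl this, ← Finset.sum_smul, hw1, one_smul]
  constructor
  · by_contra hat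
    have := hmid b fun x hx hxb => hzero x hx (fun e => hat (e ▸ hx)) hxb
    exact hab ((midpoint_eq_right_iff (R := ℝ)).1 this)
  · by_contra hbt
    have := hmid a fun x hx hxa => hzero x hx hxa (fun e => hbt (e ▸ hx))
    exact hab ((midpoint_eq_left_iff (R := ℝ)).1 this)

/-- `a`, `b`, `c` are the three elements of `Fin 3`, in cyclic order. -/
def Cyc (a b c : Fin 3) : Prop := b = a + 1 ∧ c = a + 2

lemma Cyc.rot {a b c : Fin 3} (h : Cyc a b c) : Cyc b c a := by
  unfold Cyc at *; omega

lemma Cyc.cases {a b c : Fin 3} (h : Cyc a b c) (d : Fin 3) : d = a ∨ d = b ∨ d = c := by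
  unfold Cyc at *; omega

lemma cyc_add (a : Fin 3) : Cyc a (a + 1) (a + 2) := ⟨rfl, rfl⟩

lemma cyc_of_lt {a b : Fin 3} (h : a < b) : (∃ c, Cyc a b c) ∨ ∃ c, Cyc b a c := by
  revert h; unfold Cyc; revert a b; decide

lemma cyc_of_lt_of_lt {a b c : Fin 3} (h : a < b) (h' : b < c) : Cyc a b c := by
  unfold Cyc; omega

/-- Three clusters `p 0`, `p 1`, `p 2` of `n` points each, in convex position and counterclockwise
order, such that the circles through two points of a cluster and a point of the same or the next
cluster contain a whole cluster. -/
structure ThreeClusters (p : Fin 3 → ℕ → Pt) (n : ℕ) : Prop where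
  area_aaa : ∀ a i j k, i < j → j < k → k < n → 0 < sArea (p a i) (p a j) (p a k)
  area_aab : ∀ a b c, Cyc a b c → ∀ i j k, i < j → j < n → k < n →
    0 < sArea (p a i) (p a j) (p b k)
  area_aac : ∀ a b c, Cyc a b c → ∀ i j k, i < j → j < n → k < n →
    0 < sArea (p a i) (p a j) (p c k)
  area_abc : ∀ a b c, Cyc a b c → ∀ i j k, i < n → j < n → k < n →
    0 < sArea (p a i) (p b j) (p c k)
  circ_aaaa : ∀ a i j k l, i < j → j < k → k < l → l < n →
    inCirc (p a i) (p a j) (p a k) (p a l) ≠ 0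
  circ_aaab : ∀ a b c, Cyc a b c → ∀ i j k l, i < j → j < k → k < n → l < n →
    inCirc (p a i) (p a j) (p a k) (p b l) < 0
  circ_aaac : ∀ a b c, Cyc a b c → ∀ i j k l, i < j → j < k → k < n → l < n →
    inCirc (p a i) (p a j) (p a k) (p c l) < 0
  circ_aabc : ∀ a b c, Cyc a b c → ∀ i j k l, i < j → j < n → k < n → l < n →
    inCirc (p a i) (p a j) (p b k) (p c l) < 0
  circ_aacc : ∀ a b c, Cyc a b c → ∀ i j k l, i < j → j < n → k < l → l < n →
    inCirc (p a i) (p a j) (p c k) (p c l) < 0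

/-- The points whose index in the cluster `a` is less than `M a`. -/
def clusterSet (p : Fin 3 → ℕ → Pt) (M : Fin 3 → ℕ) : Set Pt :=
  {x | ∃ a i, i < M a ∧ x = p a i}

/-- The fan triangles, together with the central triangle. -/
def fanTriangulation (p : Fin 3 → ℕ → Pt) (M : Fin 3 → ℕ) : Set (Finset Pt) :=
  {t | (∃ a b c, Cyc a b c ∧ ∃ i, i + 1 < M a ∧ t = {p a i, p a (i + 1), p c (M c - 1)}) ∨
    t = {p 0 (M 0 - 1), p 1 (M 1 - 1), p 2 (M 2 - 1)}}

section ThreeClusters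

variable {p : Fin 3 → ℕ → Pt} {n : ℕ} {M : Fin 3 → ℕ}

lemma mem_clusterSet {a : Fin 3} {i : ℕ} (h : i < M a) : p a i ∈ clusterSet p M :=
  ⟨a, i, h, rfl⟩

lemma ThreeClusters.ne_of_ne (hp : ThreeClusters p n) (a : Fin 3) {i j : ℕ} (hi : i < n)
    (hj : j < n) (hij : i ≠ j) : p a i ≠ p a j := by
  rcases lt_or_gt_of_ne hij with h | h
  · exact (ne_of_sArea_ne_zero (hp.area_aab a _ _ (cyc_add a) i j i h hj hi).ne').1
  · exact (ne_of_sArea_ne_zero (hp.area_aab a _ _ (cyc_add a) j i j h hi hj).ne').1.symm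

lemma ThreeClusters.ne_of_cyc (hp : ThreeClusters p n) {a b c : Fin 3} (h : Cyc a b c) {i j : ℕ}
    (hi : i < n) (hj : j < n) : p a i ≠ p b j :=
  (ne_of_sArea_ne_zero (hp.area_abc a b c h i j i hi hj hi).ne').1

lemma ThreeClusters.injective (hp : ThreeClusters p n) {a b : Fin 3} {i j : ℕ} (hi : i < n)
    (hj : j < n) (h : p a i = p b j) : a = b ∧ i = j := by
  rcases (cyc_add a).cases b with rfl | rfl | rfl
  · exact ⟨rfl, by_contra fun hij => hp.ne_of_ne _ hi hj hij h⟩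
  · exact absurd h (hp.ne_of_cyc (cyc_add a) hi hj)
  · exact absurd h.symm (hp.ne_of_cyc (cyc_add a).rot.rot hj hi)

lemma clusterSet_eq_coe : clusterSet p M =
    ((Finset.univ.sigma fun a => Finset.range (M a)).image fun x : (_ : Fin 3) × ℕ => p x.1 x.2 :
      Finset Pt) := by
  ext x
  simp only [clusterSet, mem_ofPred_eq, Finset.coe_image, mem_image, Finset.mem_coe,
    Finset.mem_sigma, Finset.mem_univ, true_and, Finset.mem_range, Sigma.exists]
  exact ⟨fun ⟨a, i, h, e⟩ => ⟨a, i, h, e.symm⟩, fun ⟨a, i, h, e⟩ => ⟨a, i, h, e.symm⟩⟩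

lemma clusterSet_finite : (clusterSet p M).Finite := by
  rw [clusterSet_eq_coe]; exact Finset.finite_toSet _

lemma ThreeClusters.ncard (hp : ThreeClusters p n) (hM : ∀ a, M a ≤ n) :
    (clusterSet p M).ncard = M 0 + M 1 + M 2 := by
  rw [clusterSet_eq_coe, Set.ncard_coe_finset, Finset.card_image_of_injOn, Finset.card_sigma]
  · simp [Fin.sum_univ_three]
  · rintro ⟨a, i⟩ hi ⟨b, j⟩ hj h
    simp only [Finset.coe_sigma, Finset.coe_univ, Set.mem_sigma_iff, mem_univ, Finset.coe_range,
      mem_Iio, true_and] at hi hj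
    obtain ⟨rfl, rfl⟩ := hp.injective (hi.trans_le (hM a)) (hj.trans_le (hM b)) h
    rfl

lemma ThreeClusters.sArea_ne_zero_of_lt (hp : ThreeClusters p n) {a b c : Fin 3} {i j k : ℕ}
    (hi : i < n) (hj : j < n) (hk : k < n) (hab : a < b ∨ a = b ∧ i < j)
    (hbc : b < c ∨ b = c ∧ j < k) : sArea (p a i) (p b j) (p c k) ≠ 0 := by
  rcases hab with hab | ⟨rfl, hij⟩ <;> rcases hbc with hbc | ⟨rfl, hjk⟩
  · exact (hp.area_abc a b c (cyc_of_lt_of_lt hab hbc) i j k hi hj hk).ne'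
  · rw [← sArea_rot]
    rcases cyc_of_lt hab with ⟨d, h⟩ | ⟨d, h⟩
    · exact (hp.area_aac b d a h.rot j k i hjk hk hi).ne'
    · exact (hp.area_aab b a d h j k i hjk hk hi).ne'
  · rcases cyc_of_lt hbc with ⟨d, h⟩ | ⟨d, h⟩
    · exact (hp.area_aab a c d h i j k hij hj hk).ne'
    · exact (hp.area_aac a d c h.rot i j k hij hj hk).ne'
  · exact (hp.area_aaa a i j k hij hjk hk).ne'

lemma ThreeClusters.inCirc_ne_zero_of_lt (hp : ThreeClusters p n) {a b c d : Fin 3}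
    {i j k l : ℕ} (hi : i < n) (hj : j < n) (hk : k < n) (hl : l < n)
    (hab : a < b ∨ a = b ∧ i < j) (hbc : b < c ∨ b = c ∧ j < k) (hcd : c < d ∨ c = d ∧ k < l) :
    inCirc (p a i) (p b j) (p c k) (p d l) ≠ 0 := by
  rcases hab with hab | ⟨rfl, hij⟩ <;> rcases hbc with hbc | ⟨rfl, hjk⟩ <;>
    rcases hcd with hcd | ⟨rfl, hkl⟩
  · omega
  · rw [← inCirc_swap_pairs]
    exact (hp.circ_aabc c a b (cyc_of_lt_of_lt hab hbc).rot.rot k l i j hkl hl hi hj).ne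
  · have := hp.circ_aabc b d a (cyc_of_lt_of_lt hab hcd).rot j k l i hjk hk hl hi
    rw [inCirc_cycle] at this
    exact (neg_lt_zero.1 this).ne'
  · have h' : inCirc (p b j) (p b k) (p b l) (p a i) ≠ 0 := by
      rcases cyc_of_lt hab with ⟨e, h⟩ | ⟨e, h⟩
      · exact (hp.circ_aaac b e a h.rot j k l i hjk hkl hl hi).ne
      · exact (hp.circ_aaab b a e h j k l i hjk hkl hl hi).ne
    rw [inCirc_cycle] at h'
    exact neg_ne_zero.1 h'
  · exact (hp.circ_aabc a c d (cyc_of_lt_of_lt hbc hcd) i j k l hij hj hk hl).ne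
  · rcases cyc_of_lt hbc with ⟨e, h⟩ | ⟨e, h⟩
    · rw [← inCirc_swap_pairs]
      exact (hp.circ_aacc c e a h.rot k l i j hkl hl hij hj).ne
    · exact (hp.circ_aacc a e c h.rot i j k l hij hj hkl hl).ne
  · rcases cyc_of_lt hcd with ⟨e, h⟩ | ⟨e, h⟩
    · exact (hp.circ_aaab a d e h i j k l hij hjk hk hl).ne
    · exact (hp.circ_aaac a e d h.rot i j k l hij hjk hk hl).ne
  · exact hp.circ_aaaa a i j k l hij hjk hkl hl

/-- Distinct points of the cluster set can be enumerated by increasing labels. -/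
lemma exists_sorted_labels {m : ℕ} (x : Fin m → Pt) (hx : ∀ i, x i ∈ clusterSet p M)
    (hinj : Function.Injective x) : ∃ (a : Fin m → Fin 3) (k : Fin m → ℕ),
      (∀ i, k i < M (a i)) ∧ Set.range x = Set.range (fun i => p (a i) (k i)) ∧
      ∀ i j, i < j → a i < a j ∨ a i = a j ∧ k i < k j := by
  choose a k hk hxe using hx
  let f : Fin m → Fin 3 ×ₗ ℕ := fun i => toLex (a i, k i)
  have hf : Function.Injective f := fun i j hij => by
    have := toLex.injective hij
    rw [Prod.mk.injEq] at this
    exact hinj (by rw [hxe i, hxe j, this.1, this.2])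
  have hmono : StrictMono (f ∘ Tuple.sort f) :=
    (Tuple.monotone_sort f).strictMono_of_injective (hf.comp (Tuple.sort f).injective)
  refine ⟨a ∘ Tuple.sort f, k ∘ Tuple.sort f, fun i => hk _, ?_, fun i j hij => ?_⟩
  · rw [← (Tuple.sort f).surjective.range_comp x]
    exact congrArg Set.range (funext fun i => hxe _)
  · exact Prod.Lex.toLex_lt_toLex.1 (hmono hij)

lemma ThreeClusters.genPos (hp : ThreeClusters p n) (hM : ∀ a, M a ≤ n) :
    GenPos (clusterSet p M) := by
  constructor
  · intro u v w hu hv hw huv huw hvw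
    obtain ⟨a, k, hk, hr, hlt⟩ := exists_sorted_labels (p := p) (M := M) ![u, v, w]
      (by intro i; fin_cases i <;> simpa)
      (by intro i j; fin_cases i <;> fin_cases j <;> simp [huv, huw, hvw, huv.symm, huw.symm,
            hvw.symm])
    have hkn : ∀ i, k i < n := fun i => (hk i).trans_le (hM _)
    have e1 : ({u, v, w} : Set Pt) = Set.range ![u, v, w] := by
      ext x; simp; tauto
    have e2 : Set.range (fun i => p (a i) (k i)) =
        {p (a 0) (k 0), p (a 1) (k 1), p (a 2) (k 2)} := by
      ext x; simp [Fin.exists_fin_succ, eq_comm]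
    rw [e1, hr, e2]
    exact not_collinear_of_sArea_ne_zero (hp.sArea_ne_zero_of_lt (hkn 0) (hkn 1) (hkn 2)
      (hlt 0 1 (by decide)) (hlt 1 2 (by decide)))
  · intro u v w z hu hv hw hz huv huw huz hvw hvz hwz
    obtain ⟨a, k, hk, hr, hlt⟩ := exists_sorted_labels (p := p) (M := M) ![u, v, w, z]
      (by intro i; fin_cases i <;> simpa)
      (by intro i j; fin_cases i <;> fin_cases j <;> simp [huv, huw, hvw, huz, hvz, hwz, huv.symm,
            huw.symm, hvw.symm, huz.symm, hvz.symm, hwz.symm])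
    have hkn : ∀ i, k i < n := fun i => (hk i).trans_le (hM _)
    have e1 : ({u, v, w, z} : Set Pt) = Set.range ![u, v, w, z] := by
      ext x; simp; tauto
    have e2 : Set.range (fun i => p (a i) (k i)) =
        {p (a 0) (k 0), p (a 1) (k 1), p (a 2) (k 2), p (a 3) (k 3)} := by
      ext x; simp [Fin.exists_fin_succ, eq_comm]
    rw [e1, hr, e2]
    exact not_cospherical_of_inCirc_ne_zero (hp.inCirc_ne_zero_of_lt (hkn 0) (hkn 1) (hkn 2)
      (hkn 3) (hlt 0 1 (by decide)) (hlt 1 2 (by decide)) (hlt 2 3 (by decide)))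

lemma fan_mem {a b c : Fin 3} (h : Cyc a b c) {i : ℕ} (hi : i + 1 < M a) :
    {p a i, p a (i + 1), p c (M c - 1)} ∈ fanTriangulation p M :=
  Or.inl ⟨a, b, c, h, i, hi, rfl⟩

lemma center_eq {a b c : Fin 3} (h : Cyc a b c) :
    ({p a (M a - 1), p b (M b - 1), p c (M c - 1)} : Finset Pt) =
      {p 0 (M 0 - 1), p 1 (M 1 - 1), p 2 (M 2 - 1)} := by
  obtain ⟨rfl, rfl⟩ := h
  ext x
  fin_cases a <;> simp <;> tauto

/-- A hull edge inside a cluster. -/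
lemma ThreeClusters.sArea_pos_succ (hp : ThreeClusters p n) (hM : ∀ a, M a ≤ n) {a : Fin 3}
    {i : ℕ} (hi : i + 1 < M a) {x : Pt} (hx : x ∈ clusterSet p M) (h1 : x ≠ p a i)
    (h2 : x ≠ p a (i + 1)) : 0 < sArea (p a i) (p a (i + 1)) x := by
  obtain ⟨d, j, hj, rfl⟩ := hx
  have hi' := hi.trans_le (hM a)
  have hj' := hj.trans_le (hM d)
  rcases (cyc_add a).cases d with rfl | rfl | rfl
  · have hji : j ≠ i := fun e => h1 (by rw [e])
    have hji' : j ≠ i + 1 := fun e => h2 (by rw [e])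
    rcases lt_or_gt_of_ne hji with h | h
    · rw [sArea_rot]
      exact hp.area_aaa _ j i (i + 1) h (by omega) hi'
    · exact hp.area_aaa _ i (i + 1) j (by omega) (by omega) hj'
  · exact hp.area_aab _ _ _ (cyc_add a) i (i + 1) j (by omega) hi' hj'
  · exact hp.area_aac _ _ _ (cyc_add a) i (i + 1) j (by omega) hi' hj'

/-- A hull edge between two clusters. -/
lemma ThreeClusters.sArea_nonneg_between (hp : ThreeClusters p n) (hM : ∀ a, M a ≤ n)
    (hM2 : ∀ a, 2 ≤ M a) {a b c : Fin 3} (h : Cyc a b c) {x : Pt} (hx : x ∈ clusterSet p M) :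
    0 ≤ sArea (p a (M a - 1)) (p b 0) x := by
  obtain ⟨d, j, hj, rfl⟩ := hx
  have := hM a
  have := hM2 a
  have := hM b
  have := hM2 b
  have hj' := hj.trans_le (hM d)
  rcases h.cases d with rfl | rfl | rfl
  · rcases eq_or_ne j (M d - 1) with rfl | hne
    · rw [sArea_self_left]
    · rw [← sArea_rot, ← sArea_rot]
      exact (hp.area_aab _ _ _ h j (M d - 1) 0 (by omega) (by omega) (by omega)).le
  · rcases eq_or_ne j 0 with rfl | hne
    · rw [sArea_self_right]
    · rw [← sArea_rot]
      exact (hp.area_aac _ _ _ h.rot 0 j (M a - 1) (by omega) (by omega) (by omega)).le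
  · exact (hp.area_abc _ _ _ h _ _ _ (by omega) (by omega) hj').le

lemma ThreeClusters.sArea_fan_pos (hp : ThreeClusters p n) (hM : ∀ a, M a ≤ n)
    (hM2 : ∀ a, 2 ≤ M a) {a b c : Fin 3} (h : Cyc a b c) {i j : ℕ} (hij : i < j) (hj : j < M a) :
    0 < sArea (p a i) (p a j) (p c (M c - 1)) := by
  have := hM a
  have := hM c
  have := hM2 c
  exact hp.area_aac a b c h i j _ hij (by omega) (by omega)

lemma ThreeClusters.sArea_center_pos (hp : ThreeClusters p n) (hM : ∀ a, M a ≤ n)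
    (hM2 : ∀ a, 2 ≤ M a) {a b c : Fin 3} (h : Cyc a b c) :
    0 < sArea (p a (M a - 1)) (p b (M b - 1)) (p c (M c - 1)) := by
  exact hp.area_abc a b c h _ _ _ (by have := hM a; have := hM2 a; omega)
    (by have := hM b; have := hM2 b; omega) (by have := hM c; have := hM2 c; omega)

lemma ThreeClusters.exists_pos_area (hp : ThreeClusters p n) (hM : ∀ a, M a ≤ n)
    (hM2 : ∀ a, 2 ≤ M a) {t : Finset Pt} (ht : t ∈ fanTriangulation p M) :
    ∃ x y z, t = {x, y, z} ∧ 0 < sArea x y z ∧ x ∈ clusterSet p M ∧ y ∈ clusterSet p M ∧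
      z ∈ clusterSet p M := by
  have hlast : ∀ a, p a (M a - 1) ∈ clusterSet p M := fun a =>
    mem_clusterSet (by have := hM2 a; omega)
  rcases ht with ⟨a, b, c, h, i, hi, rfl⟩ | rfl
  · exact ⟨_, _, _, rfl, hp.sArea_fan_pos hM hM2 h (by omega) hi,
      mem_clusterSet (by omega), mem_clusterSet hi, hlast c⟩
  · exact ⟨_, _, _, rfl, hp.sArea_center_pos hM hM2 (cyc_add 0), hlast _, hlast _, hlast _⟩

lemma card_eq_three_of_sArea_ne_zero {x y z : Pt} (h : sArea x y z ≠ 0) :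
    ({x, y, z} : Finset Pt).card = 3 := by
  obtain ⟨h1, h2, h3⟩ := ne_of_sArea_ne_zero h
  exact Finset.card_eq_three.2 ⟨x, y, z, h1, h3, h2, rfl⟩

/-- The line from the last point of `c` to the last point of `a` has the other clusters `b` and `c`
on its nonnegative side. -/
lemma ThreeClusters.sArea_chord_nonneg (hp : ThreeClusters p n) (hM : ∀ a, M a ≤ n)
    (hM2 : ∀ a, 2 ≤ M a) {a b c : Fin 3} (h : Cyc a b c) {d : Fin 3} {j : ℕ} (hd : d ≠ a)
    (hj : j < M d) : 0 ≤ sArea (p c (M c - 1)) (p a (M a - 1)) (p d j) := by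
  have := hM a
  have := hM2 a
  have := hM c
  have := hM2 c
  have hj' := hj.trans_le (hM d)
  rcases h.cases d with rfl | rfl | rfl
  · exact absurd rfl hd
  · exact (hp.area_abc _ _ _ h.rot.rot _ _ _ (by omega) (by omega) hj').le
  · rcases eq_or_ne j (M d - 1) with rfl | hne
    · rw [sArea_self_left]
    · rw [sArea_rot]
      exact (hp.area_aab _ _ _ h.rot.rot j (M d - 1) _ (by omega) (by omega) (by omega)).le

lemma ThreeClusters.interior_disjoint_fan (hp : ThreeClusters p n) (hM : ∀ a, M a ≤ n)
    (hM2 : ∀ a, 2 ≤ M a) {a b c : Fin 3} (h : Cyc a b c) {i j : ℕ} (hij : i < j)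
    (hj : j < M a) {s : Finset Pt} (hs : ∀ x ∈ s, 0 ≤ sArea (p c (M c - 1)) (p a j) x) :
    interior (triSet {p a i, p a (i + 1), p c (M c - 1)}) ∩ interior (triSet s) = ∅ := by
  have hneg : ∀ l, l ≤ j → sArea (p c (M c - 1)) (p a j) (p a l) ≤ 0 := fun l hl => by
    rcases hl.eq_or_lt with rfl | hl
    · rw [sArea_self_right]
    · have := hp.sArea_fan_pos hM hM2 h hl hj
      rw [← sArea_rot, sArea_swap]
      linarith
  refine interior_disjoint_of_separated (a := p c (M c - 1)) (b := p a j) ?_ ?_ hs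
  · exact (hp.ne_of_cyc h.rot.rot (by have := hM c; have := hM2 c; omega)
      (hj.trans_le (hM a)))
  · intro x hx
    simp only [Finset.mem_insert, Finset.mem_singleton] at hx
    rcases hx with rfl | rfl | rfl
    · exact hneg _ hij.le
    · exact hneg _ hij
    · rw [sArea_self_left]

lemma ThreeClusters.fan_pairwise (hp : ThreeClusters p n) (hM : ∀ a, M a ≤ n)
    (hM2 : ∀ a, 2 ≤ M a) : (fanTriangulation p M).Pairwise fun t s =>
      interior (triSet t) ∩ interior (triSet s) = ∅ := by
  have hcenter : ∀ {a b c : Fin 3}, Cyc a b c → ∀ {i}, i + 1 < M a →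
      interior (triSet {p a i, p a (i + 1), p c (M c - 1)}) ∩
        interior (triSet {p 0 (M 0 - 1), p 1 (M 1 - 1), p 2 (M 2 - 1)}) = ∅ := by
    intro a b c h i hi
    refine hp.interior_disjoint_fan hM hM2 h (j := M a - 1) (by omega) (by omega) ?_
    rw [← center_eq h]
    have := hM2 b
    simp [sArea_self_left, sArea_self_right,
      hp.sArea_chord_nonneg hM hM2 h (d := b) (j := M b - 1) (by unfold Cyc at h; omega)
        (by omega)]
  have hsame : ∀ {a b c : Fin 3}, Cyc a b c → ∀ {i j}, i < j → j + 1 < M a →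
      interior (triSet {p a i, p a (i + 1), p c (M c - 1)}) ∩
        interior (triSet {p a j, p a (j + 1), p c (M c - 1)}) = ∅ := by
    intro a b c h i j hij hj
    refine hp.interior_disjoint_fan hM hM2 h hij (by omega) ?_
    have := hp.sArea_fan_pos hM hM2 h (Nat.lt_succ_self j) hj
    rw [← sArea_rot, ← sArea_rot] at this
    simp [sArea_self_left, sArea_self_right, this.le]
  intro t ht s hs hne
  rcases ht with ⟨a, b, c, h, i, hi, rfl⟩ | rfl <;>
    rcases hs with ⟨a', b', c', h', j, hj, rfl⟩ | rfl
  · by_cases haa : a' = a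
    · subst haa
      obtain rfl : c' = c := by unfold Cyc at h h'; omega
      rcases lt_trichotomy i j with hij | rfl | hij
      · exact hsame h hij hj
      · exact absurd rfl hne
      · rw [inter_comm]
        exact hsame h hij hi
    · refine hp.interior_disjoint_fan hM hM2 h (j := M a - 1) (by omega) (by omega) ?_
      intro x hx
      simp only [Finset.mem_insert, Finset.mem_singleton] at hx
      rcases hx with rfl | rfl | rfl
      · exact hp.sArea_chord_nonneg hM hM2 h haa (by omega)
      · exact hp.sArea_chord_nonneg hM hM2 h haa hj
      · by_cases hca : c' = a
        · rw [hca, sArea_self_right]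
        · exact hp.sArea_chord_nonneg hM hM2 h hca (by have := hM2 c'; omega)
  · exact hcenter h hi
  · rw [inter_comm]
    exact hcenter h' hj
  · exact absurd rfl hne

lemma exists_sign_change {f : ℕ → ℝ} {m : ℕ} (h0 : 0 ≤ f 0) (hm : f m < 0) :
    ∃ i, i < m ∧ 0 ≤ f i ∧ f (i + 1) < 0 := by
  induction m with
  | zero => exact absurd hm (not_lt.2 h0)
  | succ m ih =>
    by_cases h : f m < 0
    · obtain ⟨i, hi, h⟩ := ih h
      exact ⟨i, by omega, h⟩
    · exact ⟨m, by omega, not_lt.1 h, hm⟩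

lemma ThreeClusters.fan_cover (hp : ThreeClusters p n) (hM : ∀ a, M a ≤ n)
    (hM2 : ∀ a, 2 ≤ M a) {x : Pt} (hx : x ∈ convexHull ℝ (clusterSet p M)) :
    ∃ t ∈ fanTriangulation p M, x ∈ triSet t := by
  by_cases hall : ∀ a b c, Cyc a b c → 0 ≤ sArea (p a (M a - 1)) (p b (M b - 1)) x
  · refine ⟨_, Or.inr rfl, ?_⟩
    have hc := cyc_add 0
    rw [← center_eq hc]
    simpa [triSet] using mem_convexHull_of_sArea_nonneg (hp.sArea_center_pos hM hM2 hc)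
      (hall _ _ _ hc) (hall _ _ _ hc.rot) (hall _ _ _ hc.rot.rot)
  · push Not at hall
    obtain ⟨c, a, b, h, hneg⟩ := hall
    have h' := h.rot
    obtain ⟨i, hi, hi0, hi1⟩ := exists_sign_change
      (f := fun i => sArea (p c (M c - 1)) (p a i) x) (m := M a - 1)
      (sArea_nonneg_of_mem_convexHull
        (fun y hy => hp.sArea_nonneg_between hM hM2 h hy) hx) hneg
    have hi' : i + 1 < M a := by omega
    refine ⟨_, fan_mem h' hi', ?_⟩
    have he : 0 ≤ sArea (p a i) (p a (i + 1)) x := by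
      refine sArea_nonneg_of_mem_convexHull (fun y hy => ?_) hx
      by_cases h1 : y = p a i
      · rw [h1, sArea_self_left]
      by_cases h2 : y = p a (i + 1)
      · rw [h2, sArea_self_right]
      exact (hp.sArea_pos_succ hM hi' hy h1 h2).le
    have := mem_convexHull_of_sArea_nonneg (hp.sArea_fan_pos hM hM2 h' (Nat.lt_succ_self i) hi')
      he (by rw [sArea_swap]; linarith) hi0
    simpa [triSet] using this

lemma ThreeClusters.fan_isTriangulation (hp : ThreeClusters p n) (hM : ∀ a, M a ≤ n)
    (hM2 : ∀ a, 2 ≤ M a) : IsTriangulation (clusterSet p M) (fanTriangulation p M) := by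
  have hverts : ∀ t ∈ fanTriangulation p M, t.card = 3 ∧ (t : Set Pt) ⊆ clusterSet p M := by
    intro t ht
    obtain ⟨x, y, z, rfl, hpos, hx, hy, hz⟩ := hp.exists_pos_area hM hM2 ht
    refine ⟨card_eq_three_of_sArea_ne_zero hpos.ne', ?_⟩
    simp [Set.insert_subset_iff, hx, hy, hz]
  refine ⟨?_, hverts, ?_, hp.fan_pairwise hM hM2, ?_⟩
  · have hfin : {t : Finset Pt | (t : Set Pt) ⊆ clusterSet p M}.Finite := by
      rw [← clusterSet_finite.coe_toFinset]
      simp only [Finset.coe_subset]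
      exact (clusterSet_finite.toFinset.powerset.finite_toSet).subset
        fun t ht => Finset.mem_coe.2 (Finset.mem_powerset.2 ht)
    exact hfin.subset fun t ht => (hverts t ht).2
  · rintro x ⟨a, i, hi, rfl⟩
    have := hM2 a
    by_cases h : i + 1 < M a
    · exact ⟨_, fan_mem (cyc_add a) h, by simp⟩
    · obtain ⟨j, rfl⟩ : ∃ j, i = j + 1 := ⟨i - 1, by omega⟩
      exact ⟨_, fan_mem (cyc_add a) hi, by simp⟩
  · apply Set.Subset.antisymm
    · exact iUnion₂_subset fun t ht => convexHull_mono (hverts t ht).2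
    · intro x hx
      obtain ⟨t, ht, hxt⟩ := hp.fan_cover hM hM2 hx
      exact mem_biUnion ht hxt

lemma ThreeClusters.fan_orderKTri (hp : ThreeClusters p n) (hM : ∀ a, M a ≤ n)
    (hM2 : ∀ a, 2 ≤ M a) (k : ℕ) {t : Finset Pt} (ht : t ∈ fanTriangulation p M) :
    OrderKTri (clusterSet p M) k t := by
  have hlast : ∀ a, M a - 1 < n := fun a => by have := hM a; have := hM2 a; omega
  rcases ht with ⟨a, b, c, h, i, hi, rfl⟩ | rfl
  · refine orderKTri_of_inCirc_nonneg (hp.sArea_fan_pos hM hM2 h (Nat.lt_succ_self i) hi) ?_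
    rintro x ⟨d, j, hj, rfl⟩
    have hi' := hi.trans_le (hM a)
    have hj' := hj.trans_le (hM d)
    rcases h.cases d with rfl | rfl | rfl
    · rcases lt_trichotomy j i with hji | rfl | hji
      · rw [inCirc_cycle]
        have := hp.circ_aaac d b c h j i (i + 1) (M c - 1) hji (by omega) hi' (hlast c)
        linarith
      · rw [inCirc_self₁]
      · rcases (show i + 1 ≤ j from hji).eq_or_lt with rfl | hji
        · rw [inCirc_self₂]
        · rw [inCirc_swap₃₄]
          have := hp.circ_aaac d b c h i (i + 1) j (M c - 1) (by omega) hji hj' (hlast c)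
          linarith
    · rw [inCirc_swap₃₄]
      have := hp.circ_aabc a d c h i (i + 1) j (M c - 1) (by omega) hi' hj' (hlast c)
      linarith
    · rcases eq_or_ne j (M d - 1) with rfl | hne
      · rw [inCirc_self₃]
      · rw [inCirc_swap₃₄]
        have := hp.circ_aacc a b d h i (i + 1) j (M d - 1) (by omega) hi' (by omega) (hlast d)
        linarith
  · have key : ∀ {a b c : Fin 3}, Cyc a b c → ∀ {j}, j < M a →
        0 ≤ inCirc (p a (M a - 1)) (p b (M b - 1)) (p c (M c - 1)) (p a j) := by
      intro a b c h j hj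
      rcases eq_or_ne j (M a - 1) with rfl | hne
      · rw [inCirc_self₁]
      · rw [inCirc_cycle]
        have := hp.circ_aabc a b c h j _ _ _ (show j < M a - 1 by omega) (hlast a) (hlast b)
          (hlast c)
        linarith
    rw [← center_eq (cyc_add 0)]
    refine orderKTri_of_inCirc_nonneg (hp.sArea_center_pos hM hM2 (cyc_add 0)) ?_
    rintro x ⟨d, j, hj, rfl⟩
    rcases (cyc_add 0).cases d with rfl | rfl | rfl
    · exact key (cyc_add 0) hj
    · rw [← inCirc_rot]
      exact key (cyc_add 0).rot hj
    · rw [← inCirc_rot, ← inCirc_rot]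
      exact key (cyc_add 0).rot.rot hj

lemma ThreeClusters.not_orderKTri_of_cluster (hp : ThreeClusters p n) (hM : ∀ a, M a ≤ n) {k : ℕ}
    (hk : ∀ a, k < M a) {t : Finset Pt} {x y z : Pt} (hx : x ∈ t) (hy : y ∈ t) (hz : z ∈ t)
    (d : Fin 3) (h : ∀ l, l < M d → sArea x y z * inCirc x y z (p d l) < 0) :
    ¬ OrderKTri (clusterSet p M) k t := by
  refine not_orderKTri hx hy hz ((Finset.range (M d)).image (p d)) ?_ ?_ ?_
  · intro y hy
    simp only [Finset.coe_image, Finset.coe_range, mem_image, mem_Iio] at hy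
    obtain ⟨l, hl, rfl⟩ := hy
    exact mem_clusterSet hl
  · rw [Finset.card_image_of_injOn, Finset.card_range]
    · exact hk d
    · intro i hi j hj hij
      simp only [Finset.coe_range, mem_Iio] at hi hj
      exact (hp.injective (hi.trans_le (hM d)) (hj.trans_le (hM d)) hij).2
  · intro y hy
    simp only [Finset.mem_image, Finset.mem_range] at hy
    obtain ⟨l, hl, rfl⟩ := hy
    exact h l hl

lemma exists_third_vertex {t : Finset Pt} (ht : t.card = 3) {x y : Pt} (hx : x ∈ t) (hy : y ∈ t)
    (hxy : x ≠ y) : ∃ z, z ≠ x ∧ z ≠ y ∧ t = {x, y, z} := by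
  have hy' : y ∈ t.erase x := Finset.mem_erase.2 ⟨hxy.symm, hy⟩
  have h1 : ((t.erase x).erase y).card = 1 := by
    rw [Finset.card_erase_of_mem hy', Finset.card_erase_of_mem hx, ht]
  obtain ⟨z, hz⟩ := Finset.card_eq_one.1 h1
  have hzm : z ∈ (t.erase x).erase y := by rw [hz]; simp
  simp only [Finset.mem_erase] at hzm
  refine ⟨z, hzm.2.1, hzm.1, ?_⟩
  rw [← Finset.insert_erase hx, ← Finset.insert_erase hy', hz]

/-- An order-`k` triangle with two vertices in a cluster has its third one in the previous
cluster. -/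
lemma ThreeClusters.third_vertex (hp : ThreeClusters p n) (hM : ∀ a, M a ≤ n) {k : ℕ}
    (hk : ∀ a, k < M a) {t : Finset Pt} (hcard : t.card = 3) (hsub : (t : Set Pt) ⊆ clusterSet p M)
    (hord : OrderKTri (clusterSet p M) k t) {a b c : Fin 3} (h : Cyc a b c) {i j : ℕ}
    (hi : i < M a) (hj : j < M a) (hij : i ≠ j) (hit : p a i ∈ t) (hjt : p a j ∈ t) :
    ∃ l, l < M c ∧ t = {p a i, p a j, p c l} := by
  have hn : ∀ {d : Fin 3} {l : ℕ}, l < M d → l < n := fun {d l} hl => hl.trans_le (hM d)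
  have hne := hp.ne_of_ne a (hn hi) (hn hj) hij
  obtain ⟨z, hz1, hz2, ht⟩ := exists_third_vertex hcard hit hjt hne
  have hzt : z ∈ t := by rw [ht]; simp
  obtain ⟨d, l, hl, rfl⟩ := hsub hzt
  have haaa : ∀ u v w, u < v → v < w → w < M a → p a u ∈ t → p a v ∈ t → p a w ∈ t → False := by
    intro u v w huv hvw hw hut hvt hwt
    refine hp.not_orderKTri_of_cluster hM hk hut hvt hwt b (fun m hm => ?_) hord
    exact mul_neg_of_pos_of_neg (hp.area_aaa a u v w huv hvw (hn hw))
      (hp.circ_aaab a b c h u v w m huv hvw (hn hw) (hn hm))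
  have haab : ∀ u v w, u < v → v < M a → w < M b → p a u ∈ t → p a v ∈ t → p b w ∈ t → False := by
    intro u v w huv hv hw hut hvt hwt
    refine hp.not_orderKTri_of_cluster hM hk hut hvt hwt c (fun m hm => ?_) hord
    exact mul_neg_of_pos_of_neg (hp.area_aab a b c h u v w huv (hn hv) (hn hw))
      (hp.circ_aabc a b c h u v w m huv (hn hv) (hn hw) (hn hm))
  rcases h.cases d with rfl | rfl | rfl
  · have hli : l ≠ i := fun e => hz1 (by rw [e])
    have hlj : l ≠ j := fun e => hz2 (by rw [e])
    exfalso
    rcases lt_or_gt_of_ne hij with h1 | h1 <;> rcases lt_or_gt_of_ne hli with h2 | h2 <;>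
      rcases lt_or_gt_of_ne hlj with h3 | h3 <;>
      first
      | omega
      | exact haaa _ _ _ h1 h3 hl hit hjt hzt
      | exact haaa _ _ _ h2 h1 hj hzt hit hjt
      | exact haaa _ _ _ h2 h3 hj hit hzt hjt
      | exact haaa _ _ _ h1 h2 hl hjt hit hzt
      | exact haaa _ _ _ h3 h1 hi hzt hjt hit
      | exact haaa _ _ _ h3 h2 hi hjt hzt hit
  · exfalso
    rcases lt_or_gt_of_ne hij with h1 | h1
    · exact haab i j l h1 hj hl hit hjt hzt
    · exact haab j i l h1 hi hl hjt hit hzt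
  · exact ⟨l, hl, ht⟩

lemma IsTriangulation.false_of_cone {P : Set Pt} {T : Set (Finset Pt)} (hT : IsTriangulation P T)
    {v q w a x : Pt} (hs : {v, q, w} ∈ T) (ht : {v, a, x} ∈ T) (hD : 0 < sArea v q w)
    (h1 : 0 < sArea v q a) (h2 : 0 < sArea v a w) (hx : sArea v a x ≠ 0)
    (hne : ({v, q, w} : Finset Pt) ≠ {v, a, x}) : False := by
  obtain ⟨y, hy⟩ := interior_inter_nonempty_of_cone hD h1 h2 hx
  exact Set.eq_empty_iff_forall_notMem.1 (hT.2.2.2.1 hs ht hne) y hy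

lemma ThreeClusters.sArea_ne_zero (hp : ThreeClusters p n) (hM : ∀ a, M a ≤ n) {x y z : Pt}
    (hx : x ∈ clusterSet p M) (hy : y ∈ clusterSet p M) (hz : z ∈ clusterSet p M) (hxy : x ≠ y)
    (hxz : x ≠ z) (hyz : y ≠ z) : sArea x y z ≠ 0 :=
  fun h => (hp.genPos hM).1 x y z hx hy hz hxy hxz hyz (collinear_of_sArea_eq_zero hxy h)

section Unique

variable {k : ℕ} {T : Set (Finset Pt)}

/-- Each side inside a cluster lies in a triangle with apex in the previous cluster. -/
lemma ThreeClusters.exists_side_triangle (hp : ThreeClusters p n) (hM : ∀ a, M a ≤ n)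
    (hk : ∀ a, k < M a) (hT : IsOrderDT (clusterSet p M) k T) {a b c : Fin 3} (h : Cyc a b c)
    {i : ℕ} (hi : i + 1 < M a) : ∃ l, l < M c ∧ {p a i, p a (i + 1), p c l} ∈ T := by
  obtain ⟨t, ht, h1, h2⟩ := exists_triangle_of_hull_edge hT.1 (a := p a i) (b := p a (i + 1))
    (mem_clusterSet (by omega)) (mem_clusterSet hi)
    fun x hx hx1 hx2 => hp.sArea_pos_succ hM hi hx hx1 hx2
  obtain ⟨l, hl, rfl⟩ := hp.third_vertex hM hk (hT.1.2.1 t ht).1 (hT.1.2.1 t ht).2 (hT.2 t ht) h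
    (by omega) hi (by omega) h1 h2
  exact ⟨l, hl, ht⟩

/-- The only point of `c` joined to the next cluster `a` by a side of a triangle is the last
one. -/
lemma ThreeClusters.eq_last_of_mem (hp : ThreeClusters p n) (hM : ∀ a, M a ≤ n)
    (hk : ∀ a, k < M a) (hT : IsOrderDT (clusterSet p M) k T) {a b c : Fin 3} (h : Cyc a b c)
    {t : Finset Pt} (ht : t ∈ T) {i l : ℕ} (hi : i < M a) (hl : l < M c) (hit : p a i ∈ t)
    (hlt : p c l ∈ t) : l = M c - 1 := by
  by_contra hne
  have hn : ∀ {d : Fin 3} {l : ℕ}, l < M d → l < n := fun {d l} hl => hl.trans_le (hM d)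
  have hl1 : l + 1 < M c := by omega
  obtain ⟨w, hw, hs⟩ := hp.exists_side_triangle hM hk hT h.rot.rot hl1
  have hca := hp.ne_of_cyc h.rot.rot (hn hl) (hn hi)
  obtain ⟨x, hx1, hx2, rfl⟩ := exists_third_vertex (hT.1.2.1 t ht).1 hlt hit hca
  have hx := (hT.1.2.1 _ ht).2 (show x ∈ (({p c l, p a i, x} : Finset Pt) : Set Pt) by simp)
  refine hT.1.false_of_cone hs ht
    (hp.area_aac c a b h.rot.rot l (l + 1) w (by omega) (hn hl1) (hn hw))
    (hp.area_aab c a b h.rot.rot l (l + 1) i (by omega) (hn hl1) (hn hi))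
    (hp.area_abc c a b h.rot.rot l i w (hn hl) (hn hi) (hn hw))
    (hp.sArea_ne_zero hM (mem_clusterSet hl) (mem_clusterSet hi) hx hca hx1.symm hx2.symm) ?_
  intro he
  have : p a i ∈ ({p c l, p c (l + 1), p b w} : Finset Pt) := by rw [he]; simp
  simp only [Finset.mem_insert, Finset.mem_singleton] at this
  rcases this with e | e | e
  · exact hca e.symm
  · exact hp.ne_of_cyc h.rot.rot (hn hl1) (hn hi) e.symm
  · exact hp.ne_of_cyc h (hn hi) (hn hw) e

lemma ThreeClusters.subset_fan (hp : ThreeClusters p n) (hM : ∀ a, M a ≤ n)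
    (hk : ∀ a, k < M a) (hT : IsOrderDT (clusterSet p M) k T) : T ⊆ fanTriangulation p M := by
  have hn : ∀ {d : Fin 3} {l : ℕ}, l < M d → l < n := fun {d l} hl => hl.trans_le (hM d)
  intro t ht
  obtain ⟨hcard, hsub⟩ := hT.1.2.1 t ht
  have hlast := @ThreeClusters.eq_last_of_mem p n M k T hp hM hk hT
  have hsame : ∀ a i j, i < j → j < M a → p a i ∈ t → p a j ∈ t → t ∈ fanTriangulation p M := by
    intro a i j hij hj hit hjt
    have h := cyc_add a
    obtain ⟨l, hl, rfl⟩ := hp.third_vertex hM hk hcard hsub (hT.2 t ht) h (hij.trans hj) hj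
      hij.ne hit hjt
    obtain rfl := hlast h ht hj hl (by simp) (by simp)
    rcases (show i + 1 ≤ j from hij).eq_or_lt with rfl | hij'
    · exact fan_mem h hj
    · exfalso
      have hi1 := hij'.trans hj
      obtain ⟨l', hl', hs⟩ := hp.exists_side_triangle hM hk hT h hi1
      obtain rfl := hlast h hs hi1 hl' (by simp) (by simp)
      have e1 : ∀ x y z : Pt, ({x, y, z} : Finset Pt) = {z, x, y} := fun x y z => by
        ext; simp; tauto
      have e2 : ∀ x y z : Pt, ({x, y, z} : Finset Pt) = {z, y, x} := fun x y z => by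
        ext; simp; tauto
      have h1 := hp.area_aac a _ _ h i j _ hij (hn hj) (hn hl)
      have h2 := hp.area_aac a _ _ h i (i + 1) _ (Nat.lt_succ_self i) (hn hi1) (hn hl)
      have h3 := hp.area_aac a _ _ h (i + 1) j _ hij' (hn hj) (hn hl)
      rw [← sArea_rot, ← sArea_rot] at h1 h2 h3
      rw [e1] at ht
      rw [e2] at hs
      refine hT.1.false_of_cone ht hs h1 h2 h3 ?_ ?_
      · rw [sArea_swap_right]
        exact neg_ne_zero.2 h2.ne'
      · intro he
        have : p a (i + 1) ∈ ({p (a + 2) (M (a + 2) - 1), p a i, p a j} : Finset Pt) := by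
          rw [he]; simp
        simp only [Finset.mem_insert, Finset.mem_singleton] at this
        rcases this with e | e | e
        · exact hp.ne_of_cyc h.rot.rot (hn hl) (hn hi1) e.symm
        · exact hp.ne_of_ne a (hn hi1) (hn (hij.trans hj)) (by omega) e
        · exact hp.ne_of_ne a (hn hi1) (hn hj) (by omega) e
  have habc : ∀ a b c, Cyc a b c → ∀ i j l, i < M a → j < M b → l < M c →
      t = {p a i, p b j, p c l} → t ∈ fanTriangulation p M := by
    rintro a b c h i j l hi hj hl rfl
    obtain rfl := hlast h ht hi hl (by simp) (by simp)
    obtain rfl := hlast h.rot ht hj hi (by simp) (by simp)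
    obtain rfl := hlast h.rot.rot ht hl hj (by simp) (by simp)
    exact Or.inr (center_eq h)
  obtain ⟨x, y, z, hxy, hxz, hyz, hxyz⟩ := Finset.card_eq_three.1 hcard
  have hxt : x ∈ t := by simp [hxyz]
  have hyt : y ∈ t := by simp [hxyz]
  have hzt : z ∈ t := by simp [hxyz]
  obtain ⟨a, i, hi, rfl⟩ := hsub hxt
  obtain ⟨b, j, hj, rfl⟩ := hsub hyt
  obtain ⟨c, l, hl, rfl⟩ := hsub hzt
  have hsame' : ∀ a i j, i < M a → j < M a → p a i ≠ p a j → p a i ∈ t → p a j ∈ t →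
      t ∈ fanTriangulation p M := by
    intro a i j hi hj hne hit hjt
    rcases lt_trichotomy i j with h | rfl | h
    · exact hsame a i j h hj hit hjt
    · exact absurd rfl hne
    · exact hsame a j i h hi hjt hit
  by_cases hab : a = b
  · subst hab
    exact hsame' a i j hi hj hxy hxt hyt
  by_cases hac : a = c
  · subst hac
    exact hsame' a i l hi hl hxz hxt hzt
  by_cases hbc : b = c
  · subst hbc
    exact hsame' b j l hj hl hyz hyt hzt
  have : Cyc a b c ∨ Cyc a c b := by unfold Cyc; omega
  rcases this with h | h
  · exact habc a b c h i j l hi hj hl hxyz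
  · exact habc a c b h i l j hi hl hj (by rw [hxyz]; ext; simp; tauto)

lemma ThreeClusters.existsUnique (hp : ThreeClusters p n) (hM : ∀ a, M a ≤ n)
    (hM2 : ∀ a, 2 ≤ M a) (hk : ∀ a, k < M a) : ∃! T, IsOrderDT (clusterSet p M) k T := by
  have hfan := hp.fan_isTriangulation hM hM2
  refine ⟨fanTriangulation p M, ⟨hfan, fun t ht => hp.fan_orderKTri hM hM2 k ht⟩, ?_⟩
  intro T hT
  refine triangulation_eq_of_subset hfan hT.1 (fun t ht => ?_) (hp.subset_fan hM hk hT)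
  obtain ⟨x, y, z, rfl, hpos, -⟩ := hp.exists_pos_area hM hM2 ht
  exact triSet_interior_nonempty hpos.ne'

end Unique

end ThreeClusters

section Construction

/-- The determinant of three vectors of `ℝ³`. -/
def tripleProduct (u v w : ℝ × ℝ × ℝ) : ℝ :=
  u.1 * (v.2.1 * w.2.2 - v.2.2 * w.2.1) - u.2.1 * (v.1 * w.2.2 - v.2.2 * w.1) +
    u.2.2 * (v.1 * w.2.1 - v.2.1 * w.1)

/-- The determinant of the projections of two vectors of `ℝ³` to the horizontal plane. -/
def planarDet (u v : ℝ × ℝ × ℝ) : ℝ := u.1 * v.2.1 - u.2.1 * v.1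

/-- The linear map from `ℝ³` to the plane which forgets the third coordinate and sends the first two
basis vectors to unit vectors at angle `π / 3`. -/
def embed (v : ℝ × ℝ × ℝ) : Pt := !₂[v.1 + v.2.1 / 2, √3 / 2 * v.2.1]

/-- The rotation of `ℝ³` about the third axis which corresponds under `embed` to the rotation of
the plane by `2 * π / 3`. -/
def turn (v : ℝ × ℝ × ℝ) : ℝ × ℝ × ℝ := (-v.1 - v.2.1, v.1, v.2.2)

/-- The third coordinate of `v` is the squared norm of `embed v`. -/
def IsLift (v : ℝ × ℝ × ℝ) : Prop := v.2.2 = v.1 ^ 2 + v.1 * v.2.1 + v.2.1 ^ 2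

lemma IsLift.turn {v : ℝ × ℝ × ℝ} (h : IsLift v) : IsLift (turn v) := by
  unfold IsLift _root_.turn at *; rw [h]; ring

lemma turn_turn_turn (v : ℝ × ℝ × ℝ) : turn (turn (turn v)) = v := by
  refine Prod.ext ?_ (Prod.ext ?_ rfl) <;> simp only [turn] <;> ring

lemma planarDet_turn_sub (a b c d : ℝ × ℝ × ℝ) :
    planarDet (turn a - turn b) (turn c - turn d) = planarDet (a - b) (c - d) := by
  simp only [planarDet, turn, Prod.fst_sub, Prod.snd_sub]; ring

lemma tripleProduct_turn_sub (a b c d e f : ℝ × ℝ × ℝ) :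
    tripleProduct (turn a - turn b) (turn c - turn d) (turn e - turn f) =
      tripleProduct (a - b) (c - d) (e - f) := by
  simp only [tripleProduct, turn, Prod.fst_sub, Prod.snd_sub]; ring

lemma sArea_embed (a b c : ℝ × ℝ × ℝ) :
    sArea (embed a) (embed b) (embed c) = √3 / 2 * planarDet (b - a) (c - a) := by
  simp only [sArea, embed, planarDet, Prod.fst_sub, Prod.snd_sub, PiLp.toLp_apply,
    Matrix.cons_val_zero, Matrix.cons_val_one, Matrix.cons_val_fin_one]
  ring

lemma IsLift.sqNorm_embed {v : ℝ × ℝ × ℝ} (h : IsLift v) : sqNorm (embed v) = v.2.2 := by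
  simp only [sqNorm, embed, PiLp.toLp_apply,
    Matrix.cons_val_zero, Matrix.cons_val_one, Matrix.cons_val_fin_one]
  rw [h, mul_pow, div_pow, Real.sq_sqrt (by norm_num)]
  ring

lemma inCirc_embed {a b c d : ℝ × ℝ × ℝ} (ha : IsLift a) (hb : IsLift b) (hc : IsLift c)
    (hd : IsLift d) : inCirc (embed a) (embed b) (embed c) (embed d) =
      √3 / 2 * tripleProduct (b - a) (c - a) (d - a) := by
  simp only [inCirc, ha.sqNorm_embed, hb.sqNorm_embed, hc.sqNorm_embed, hd.sqNorm_embed,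
    sArea_embed, planarDet, tripleProduct, Prod.fst_sub, Prod.snd_sub]
  ring

/-- A convex arc on the paraboloid of lifted points. -/
def arc (s : ℝ) : ℝ × ℝ × ℝ :=
  (12 - 12 * s - s ^ 2, 12 * s - s ^ 2, 144 - 144 * s + 108 * s ^ 2 + 3 * s ^ 4)

/-- The first divided difference of `arc`. -/
def arcSlope (s t : ℝ) : ℝ × ℝ × ℝ :=
  (-12 - (s + t), 12 - (s + t), -144 + 108 * (s + t) + 3 * (s + t) * (s ^ 2 + t ^ 2))

/-- The second divided difference of `arc`. -/
def arcSlope₂ (s t r : ℝ) : ℝ × ℝ × ℝ :=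
  (-1, -1, 108 + 3 * (s ^ 2 + t ^ 2 + r ^ 2 + s * t + s * r + t * r))

/-- The three arcs obtained from `arc` by rotation. -/
def arcs (a : Fin 3) : ℝ → ℝ × ℝ × ℝ :=
  ![arc, fun s => turn (arc s), fun s => turn (turn (arc s))] a

lemma isLift_arc (s : ℝ) : IsLift (arc s) := by
  unfold IsLift arc; ring

lemma isLift_arcs (a : Fin 3) (s : ℝ) : IsLift (arcs a s) := by
  fin_cases a
  · exact isLift_arc s
  · exact (isLift_arc s).turn
  · exact (isLift_arc s).turn.turn

lemma arcs_add_one (a : Fin 3) (s : ℝ) : arcs (a + 1) s = turn (arcs a s) := by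
  fin_cases a
  · rfl
  · rfl
  · exact (turn_turn_turn _).symm

lemma arcs_add_two (a : Fin 3) (s : ℝ) : arcs (a + 2) s = turn (turn (arcs a s)) := by
  rw [← arcs_add_one, ← arcs_add_one, add_assoc]; rfl

lemma planarDet_arc (s t : ℝ) (x : ℝ × ℝ × ℝ) :
    planarDet (arc t - arc s) x = (t - s) * planarDet (arcSlope s t) x := by
  simp only [planarDet, arc, arcSlope, Prod.fst_sub, Prod.snd_sub]; ring

lemma tripleProduct_arc (s t : ℝ) (x y : ℝ × ℝ × ℝ) :
    tripleProduct (arc t - arc s) x y = (t - s) * tripleProduct (arcSlope s t) x y := by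
  simp only [tripleProduct, arc, arcSlope, Prod.fst_sub, Prod.snd_sub]; ring

lemma planarDet_arc_arc (s t r : ℝ) :
    planarDet (arc t - arc s) (arc r - arc s) = 24 * ((t - s) * (r - s) * (r - t)) := by
  simp only [planarDet, arc, Prod.fst_sub, Prod.snd_sub]; ring

lemma tripleProduct_arc_arc (s t r : ℝ) (x : ℝ × ℝ × ℝ) :
    tripleProduct (arc t - arc s) (arc r - arc s) x =
      (t - s) * (r - s) * (r - t) * tripleProduct (arcSlope s t) (arcSlope₂ s t r) x := by
  simp only [tripleProduct, arc, arcSlope, arcSlope₂, Prod.fst_sub, Prod.snd_sub]; ring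

lemma tripleProduct_arc_arc_arc (s t r q : ℝ) :
    tripleProduct (arc t - arc s) (arc r - arc s) (arc q - arc s) =
      72 * ((t - s) * (r - s) * (r - t) * ((q - s) * (q - t) * (q - r)) * (s + t + r + q)) := by
  simp only [tripleProduct, arc, Prod.fst_sub, Prod.snd_sub]; ring

lemma tripleProduct_arc_turn_arc (s t r q : ℝ) :
    tripleProduct (arc t - arc s) (turn (turn (arc r)) - arc s) (turn (turn (arc q)) - arc s) =
      (t - s) * (q - r) * tripleProduct (arcSlope s t) (turn (turn (arc r)) - arc s)
        (turn (turn (arcSlope r q))) := by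
  simp only [tripleProduct, arc, arcSlope, turn, Prod.fst_sub, Prod.snd_sub]; ring

open Filter Topology in
lemma eventually_pos_of_continuous {G : ℝ → ℝ → ℝ → ℝ → ℝ}
    (hG : Continuous fun x : ℝ × ℝ × ℝ × ℝ => G x.1 x.2.1 x.2.2.1 x.2.2.2) (h : 0 < G 0 0 0 0) :
    ∀ᶠ δ in 𝓝[>] (0 : ℝ), ∀ s ∈ Ioo 0 δ, ∀ t ∈ Ioo 0 δ, ∀ r ∈ Ioo 0 δ, ∀ q ∈ Ioo 0 δ,
      0 < G s t r q := by
  obtain ⟨ε, hε, H⟩ := Metric.eventually_nhds_iff.1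
    ((hG.tendsto (0, 0, 0, 0)).eventually_const_lt h)
  filter_upwards [Ioo_mem_nhdsGT hε] with δ hδ s hs t ht r hr q hq
  refine @H (s, t, r, q) ?_
  have habs : ∀ x ∈ Ioo 0 δ, dist x 0 < ε := fun x hx => by
    rw [Real.dist_0_eq_abs, abs_of_pos hx.1]; exact hx.2.trans hδ.2
  simp only [Prod.dist_eq, max_lt_iff]
  exact ⟨habs s hs, habs t ht, habs r hr, habs q hq⟩

lemma exists_arc_parameter : ∃ δ > 0, ∀ s ∈ Ioo 0 δ, ∀ t ∈ Ioo 0 δ, ∀ r ∈ Ioo 0 δ, ∀ q ∈ Ioo 0 δ,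
    0 < planarDet (arcSlope s t) (turn (arc r) - arc s) ∧
    0 < planarDet (arcSlope s t) (turn (turn (arc r)) - arc s) ∧
    0 < planarDet (turn (arc t) - arc s) (turn (turn (arc r)) - arc s) ∧
    0 < -tripleProduct (arcSlope s t) (arcSlope₂ s t r) (turn (arc q) - arc s) ∧
    0 < -tripleProduct (arcSlope s t) (arcSlope₂ s t r) (turn (turn (arc q)) - arc s) ∧
    0 < -tripleProduct (arcSlope s t) (turn (arc r) - arc s) (turn (turn (arc q)) - arc s) ∧
    0 < -tripleProduct (arcSlope s t) (turn (turn (arc r)) - arc s)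
      (turn (turn (arcSlope r q))) := by
  have h1 := @eventually_pos_of_continuous
    (fun s t r _ => planarDet (arcSlope s t) (turn (arc r) - arc s))
    (by simp only [planarDet, arc, arcSlope, turn, Prod.fst_sub, Prod.snd_sub]; fun_prop)
    (by norm_num [planarDet, arc, arcSlope, turn])
  have h2 := @eventually_pos_of_continuous
    (fun s t r _ => planarDet (arcSlope s t) (turn (turn (arc r)) - arc s))
    (by simp only [planarDet, arc, arcSlope, turn, Prod.fst_sub, Prod.snd_sub]; fun_prop)
    (by norm_num [planarDet, arc, arcSlope, turn])
  have h3 := @eventually_pos_of_continuous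
    (fun s t r _ => planarDet (turn (arc t) - arc s) (turn (turn (arc r)) - arc s))
    (by simp only [planarDet, arc, turn, Prod.fst_sub, Prod.snd_sub]; fun_prop)
    (by norm_num [planarDet, arc, turn])
  have h4 := @eventually_pos_of_continuous
    (fun s t r q => -tripleProduct (arcSlope s t) (arcSlope₂ s t r) (turn (arc q) - arc s))
    (by simp only [tripleProduct, arc, arcSlope, arcSlope₂, turn, Prod.fst_sub, Prod.snd_sub]
        fun_prop)
    (by norm_num [tripleProduct, arc, arcSlope, arcSlope₂, turn])
  have h5 := @eventually_pos_of_continuous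
    (fun s t r q => -tripleProduct (arcSlope s t) (arcSlope₂ s t r) (turn (turn (arc q)) - arc s))
    (by simp only [tripleProduct, arc, arcSlope, arcSlope₂, turn, Prod.fst_sub, Prod.snd_sub]
        fun_prop)
    (by norm_num [tripleProduct, arc, arcSlope, arcSlope₂, turn])
  have h6 := @eventually_pos_of_continuous
    (fun s t r q =>
      -tripleProduct (arcSlope s t) (turn (arc r) - arc s) (turn (turn (arc q)) - arc s))
    (by simp only [tripleProduct, arc, arcSlope, turn, Prod.fst_sub, Prod.snd_sub]; fun_prop)
    (by norm_num [tripleProduct, arc, arcSlope, turn])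
  have h7 := @eventually_pos_of_continuous
    (fun s t r q => -tripleProduct (arcSlope s t) (turn (turn (arc r)) - arc s)
      (turn (turn (arcSlope r q))))
    (by simp only [tripleProduct, arc, arcSlope, turn, Prod.fst_sub, Prod.snd_sub]; fun_prop)
    (by norm_num [tripleProduct, arc, arcSlope, turn])
  obtain ⟨δ, ⟨h1, h2, h3, h4, h5, h6, h7⟩, hδ⟩ :=
    ((h1.and (h2.and (h3.and (h4.and (h5.and (h6.and h7)))))).and self_mem_nhdsWithin).exists
  exact ⟨δ, hδ, fun s hs t ht r hr q hq => ⟨h1 s hs t ht r hr q hq, h2 s hs t ht r hr q hq,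
    h3 s hs t ht r hr q hq, h4 s hs t ht r hr q hq, h5 s hs t ht r hr q hq, h6 s hs t ht r hr q hq,
    h7 s hs t ht r hr q hq⟩⟩

lemma exists_threeClusters (n : ℕ) : ∃ p, ThreeClusters p n := by
  obtain ⟨δ, hδ, H⟩ := exists_arc_parameter
  obtain ⟨σ, hσ, hlt⟩ : ∃ σ : ℕ → ℝ, (∀ i < n, σ i ∈ Ioo 0 δ) ∧ ∀ i j, i < j → 0 < σ j - σ i := by
    refine ⟨fun i => δ * (i + 1) / (n + 1), fun i hi => ⟨by positivity, ?_⟩, fun i j hij => ?_⟩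
    · have : (i : ℝ) < n := mod_cast hi
      rw [div_lt_iff₀ (by positivity)]
      exact mul_lt_mul_of_pos_left (by linarith) hδ
    · have : (i : ℝ) < j := mod_cast hij
      rw [sub_pos]
      dsimp only
      gcongr
  have hc : 0 < √3 / 2 := by positivity
  have hcross : ∀ (a : Fin 3) s t r, (planarDet (arcs a t - arcs a s) (arcs a r - arcs a s) =
      planarDet (arc t - arc s) (arc r - arc s)) ∧
      (planarDet (arcs a t - arcs a s) (turn (arcs a r) - arcs a s) =
      planarDet (arc t - arc s) (turn (arc r) - arc s)) ∧
      (planarDet (arcs a t - arcs a s) (turn (turn (arcs a r)) - arcs a s) =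
      planarDet (arc t - arc s) (turn (turn (arc r)) - arc s)) ∧
      planarDet (turn (arcs a t) - arcs a s) (turn (turn (arcs a r)) - arcs a s) =
      planarDet (turn (arc t) - arc s) (turn (turn (arc r)) - arc s) := by
    intro a s t r
    fin_cases a <;> simp [arcs, planarDet_turn_sub]
  have htriple : ∀ (a : Fin 3) s t r q,
      (tripleProduct (arcs a t - arcs a s) (arcs a r - arcs a s) (arcs a q - arcs a s) =
      tripleProduct (arc t - arc s) (arc r - arc s) (arc q - arc s)) ∧
      (tripleProduct (arcs a t - arcs a s) (arcs a r - arcs a s) (turn (arcs a q) - arcs a s) =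
      tripleProduct (arc t - arc s) (arc r - arc s) (turn (arc q) - arc s)) ∧
      (tripleProduct (arcs a t - arcs a s) (arcs a r - arcs a s)
        (turn (turn (arcs a q)) - arcs a s) =
      tripleProduct (arc t - arc s) (arc r - arc s) (turn (turn (arc q)) - arc s)) ∧
      (tripleProduct (arcs a t - arcs a s) (turn (arcs a r) - arcs a s)
        (turn (turn (arcs a q)) - arcs a s) =
      tripleProduct (arc t - arc s) (turn (arc r) - arc s) (turn (turn (arc q)) - arc s)) ∧
      tripleProduct (arcs a t - arcs a s) (turn (turn (arcs a r)) - arcs a s)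
        (turn (turn (arcs a q)) - arcs a s) =
      tripleProduct (arc t - arc s) (turn (turn (arc r)) - arc s)
        (turn (turn (arc q)) - arc s) := by
    intro a s t r q
    fin_cases a <;> simp [arcs, tripleProduct_turn_sub]
  refine ⟨fun a i => embed (arcs a (σ i)), ?_, ?_, ?_, ?_, ?_, ?_, ?_, ?_, ?_⟩
  · intro a i j k hij hjk hk
    rw [sArea_embed, (hcross a _ _ _).1, planarDet_arc_arc]
    have h1 := hlt i j hij
    have h2 := hlt i k (hij.trans hjk)
    have h3 := hlt j k hjk
    positivity
  · rintro a _ _ ⟨rfl, rfl⟩ i j k hij hj hk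
    have hi := hij.trans hj
    rw [sArea_embed, arcs_add_one, (hcross a _ _ _).2.1, planarDet_arc]
    exact mul_pos hc (mul_pos (hlt i j hij) (H _ (hσ i hi) _ (hσ j hj) _ (hσ k hk) _ (hσ k hk)).1)
  · rintro a _ _ ⟨rfl, rfl⟩ i j k hij hj hk
    have hi := hij.trans hj
    rw [sArea_embed, arcs_add_two, (hcross a _ _ _).2.2.1, planarDet_arc]
    exact mul_pos hc (mul_pos (hlt i j hij)
      (H _ (hσ i hi) _ (hσ j hj) _ (hσ k hk) _ (hσ k hk)).2.1)
  · rintro a _ _ ⟨rfl, rfl⟩ i j k hi hj hk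
    rw [sArea_embed, arcs_add_one, arcs_add_two, (hcross a _ _ _).2.2.2]
    exact mul_pos hc (H _ (hσ i hi) _ (hσ j hj) _ (hσ k hk) _ (hσ k hk)).2.2.1
  · intro a i j k l hij hjk hkl hl
    have hk := hkl.trans hl
    have hj := hjk.trans hk
    have hi := hij.trans hj
    rw [inCirc_embed (isLift_arcs _ _) (isLift_arcs _ _) (isLift_arcs _ _) (isLift_arcs _ _),
      (htriple a _ _ _ _).1, tripleProduct_arc_arc_arc]
    have h1 := hlt i j hij
    have h2 := hlt i k (hij.trans hjk)
    have h3 := hlt j k hjk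
    have h4 := hlt i l (hij.trans (hjk.trans hkl))
    have h5 := hlt j l (hjk.trans hkl)
    have h6 := hlt k l hkl
    have h7 := (hσ i hi).1
    have h8 := (hσ j hj).1
    have h9 := (hσ k hk).1
    have h10 := (hσ l hl).1
    positivity
  · rintro a _ _ ⟨rfl, rfl⟩ i j k l hij hjk hk hl
    have hj := hjk.trans hk
    have hi := hij.trans hj
    rw [inCirc_embed (isLift_arcs _ _) (isLift_arcs _ _) (isLift_arcs _ _) (isLift_arcs _ _),
      arcs_add_one, (htriple a _ _ _ _).2.1, tripleProduct_arc_arc]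
    have h1 := hlt i j hij
    have h2 := hlt i k (hij.trans hjk)
    have h3 := hlt j k hjk
    exact mul_neg_of_pos_of_neg hc (mul_neg_of_pos_of_neg (by positivity)
      (neg_pos.1 (H _ (hσ i hi) _ (hσ j hj) _ (hσ k hk) _ (hσ l hl)).2.2.2.1))
  · rintro a _ _ ⟨rfl, rfl⟩ i j k l hij hjk hk hl
    have hj := hjk.trans hk
    have hi := hij.trans hj
    rw [inCirc_embed (isLift_arcs _ _) (isLift_arcs _ _) (isLift_arcs _ _) (isLift_arcs _ _),
      arcs_add_two, (htriple a _ _ _ _).2.2.1, tripleProduct_arc_arc]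
    have h1 := hlt i j hij
    have h2 := hlt i k (hij.trans hjk)
    have h3 := hlt j k hjk
    exact mul_neg_of_pos_of_neg hc (mul_neg_of_pos_of_neg (by positivity)
      (neg_pos.1 (H _ (hσ i hi) _ (hσ j hj) _ (hσ k hk) _ (hσ l hl)).2.2.2.2.1))
  · rintro a _ _ ⟨rfl, rfl⟩ i j k l hij hj hk hl
    have hi := hij.trans hj
    rw [inCirc_embed (isLift_arcs _ _) (isLift_arcs _ _) (isLift_arcs _ _) (isLift_arcs _ _),
      arcs_add_one, arcs_add_two, (htriple a _ _ _ _).2.2.2.1, tripleProduct_arc]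
    exact mul_neg_of_pos_of_neg hc (mul_neg_of_pos_of_neg (hlt i j hij)
      (neg_pos.1 (H _ (hσ i hi) _ (hσ j hj) _ (hσ k hk) _ (hσ l hl)).2.2.2.2.2.1))
  · rintro a _ _ ⟨rfl, rfl⟩ i j k l hij hj hkl hl
    have hi := hij.trans hj
    have hk := hkl.trans hl
    rw [inCirc_embed (isLift_arcs _ _) (isLift_arcs _ _) (isLift_arcs _ _) (isLift_arcs _ _),
      arcs_add_two, arcs_add_two, (htriple a _ _ _ _).2.2.2.2, tripleProduct_arc_turn_arc]
    exact mul_neg_of_pos_of_neg hc (mul_neg_of_pos_of_neg (mul_pos (hlt i j hij) (hlt k l hkl))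
      (neg_pos.1 (H _ (hσ i hi) _ (hσ j hj) _ (hσ k hk) _ (hσ l hl)).2.2.2.2.2.2))

end Construction

/-- Lemma 3.1: for every `n ≥ 6` and every `k ≤ ⌊n/3⌋ - 1`, there exists a set of `n`
points in general position having exactly one order-`k` Delaunay triangulation. -/
theorem exists_point_set_with_unique_order_k_triangulation
    (n k : ℕ) (hn : 6 ≤ n) (hk : k ≤ n / 3 - 1) :
    ∃ P : Set Pt, P.Finite ∧ P.ncard = n ∧ GenPos P ∧
      ∃! T : Set (Finset Pt), IsOrderDT P k T := by
  obtain ⟨p, hp⟩ := exists_threeClusters n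
  obtain ⟨M, h0, h1, h2⟩ : ∃ M : Fin 3 → ℕ, M 0 = n / 3 ∧ M 1 = n / 3 ∧ M 2 = n - 2 * (n / 3) :=
    ⟨![n / 3, n / 3, n - 2 * (n / 3)], rfl, rfl, rfl⟩
  have hM : ∀ a, n / 3 ≤ M a ∧ M a ≤ n := by
    intro a; fin_cases a <;> simp only [Fin.zero_eta, Fin.mk_one, Fin.reduceFinMk, *] <;> omega
  refine ⟨clusterSet p M, clusterSet_finite, ?_, hp.genPos fun a => (hM a).2,
    hp.existsUnique (fun a => (hM a).2) (fun a => ?_) fun a => ?_⟩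
  · rw [hp.ncard fun a => (hM a).2]; omega
  · have := (hM a).1; omega
  · have := (hM a).1; omega

end
end

section
/- Every set P of n ≥ 3 points in ℝ² in general position has at most 2^{n−3} order-1 Delaunay triangulations. -/
open EuclideanGeometry Set

noncomputable section

/-! ### Orientations, circles and crossing segments in coordinates -/

/-- Twice the signed area of the triangle `a b c`. -/
def orient (a b c : Pt) : ℝ := (b 0 - a 0) * (c 1 - a 1) - (b 1 - a 1) * (c 0 - a 0)

/-- The affine function with coefficients `h`. -/
def aff (h : ℝ × ℝ × ℝ) (y : Pt) : ℝ := h.1 * y 0 + h.2.1 * y 1 + h.2.2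

/-- The power of the point `y` with respect to the circle with equation
`y₀² + y₁² + aff q y = 0`. -/
def circPow (q : ℝ × ℝ × ℝ) (y : Pt) : ℝ := y 0 ^ 2 + y 1 ^ 2 + aff q y

/-- The squared distance, in coordinates. -/
def dsq (a b : Pt) : ℝ := (a 0 - b 0) ^ 2 + (a 1 - b 1) ^ 2

/-- The open segments `a b` and `c d` cross. -/
def Cross (a b c d : Pt) : Prop :=
  orient a b c * orient a b d < 0 ∧ orient c d a * orient c d b < 0

lemma dsq_nonneg (a b : Pt) : 0 ≤ dsq a b := by unfold dsq; positivity

lemma orient_rotate (a b c : Pt) : orient b c a = orient a b c := by unfold orient; ring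

lemma orient_swap (a b c : Pt) : orient b a c = -orient a b c := by unfold orient; ring

lemma orient_swap_right (a b c : Pt) : orient a c b = -orient a b c := by unfold orient; ring

lemma Cross.swap_left {a b c d : Pt} (h : Cross a b c d) : Cross b a c d := by
  unfold Cross at *
  rw [orient_swap a b c, orient_swap a b d]
  constructor <;> nlinarith [h.1, h.2]

lemma Cross.swap_right {a b c d : Pt} (h : Cross a b c d) : Cross a b d c := by
  unfold Cross at *
  rw [orient_swap c d a, orient_swap c d b]
  constructor <;> nlinarith [h.1, h.2]

lemma aff_bary (h : ℝ × ℝ × ℝ) (a b c y : Pt) :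
    orient a b c * aff h y =
      orient y b c * aff h a + orient a y c * aff h b + orient a b y * aff h c := by
  unfold orient aff; ring

lemma circPow_bary (q : ℝ × ℝ × ℝ) (a b c y : Pt) :
    orient a b c * circPow q y =
      orient y b c * (circPow q a - dsq a y) + orient a y c * (circPow q b - dsq b y) +
        orient a b y * (circPow q c - dsq c y) := by
  unfold orient circPow aff dsq; ring

lemma circPow_sub_bary (q q' : ℝ × ℝ × ℝ) (a b c y : Pt) :
    orient a b c * (circPow q y - circPow q' y) =
      orient y b c * (circPow q a - circPow q' a) + orient a y c * (circPow q b - circPow q' b) +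
        orient a b y * (circPow q c - circPow q' c) := by
  unfold orient circPow aff; ring

/-- Two circles through `c` and `d`: their power functions differ by a multiple of the
orientation function of `c d`. -/
lemma circPow_sub_pencil {q q' : ℝ × ℝ × ℝ} {c d : Pt} (hc : circPow q c = 0) (hd : circPow q d = 0)
    (hc' : circPow q' c = 0) (hd' : circPow q' d = 0) (x y : Pt) :
    orient c d x * (circPow q y - circPow q' y) = orient c d y * (circPow q x - circPow q' x) := by
  have := circPow_sub_bary q q' c d x y
  rw [hc, hd, hc', hd'] at this
  linarith

lemma circPow_neg_of_opposite {q q' : ℝ × ℝ × ℝ} {a b c d : Pt} (hc : circPow q c = 0)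
    (hd : circPow q d = 0) (ha : circPow q a = 0) (hc' : circPow q' c = 0) (hd' : circPow q' d = 0)
    (hb' : circPow q' b = 0) (hopp : orient c d a * orient c d b < 0) (hb : circPow q b < 0) :
    circPow q' a < 0 := by
  have h := circPow_sub_pencil hc hd hc' hd' a b
  rw [ha, hb'] at h
  by_contra! hn
  have h1 : orient c d a * orient c d a * circPow q b = -(orient c d a * orient c d b * circPow q' a) := by
    linear_combination orient c d a * h
  have h2 : 0 < orient c d a * orient c d a := by
    have : orient c d a ≠ 0 := by rintro h0; simp [h0] at hopp
    exact mul_self_pos.2 this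
  nlinarith

/-- Two circles through `a` and `c`, and a further point on each of them on the same side
of `a c`: if neither point lies inside the other circle then they lie on one circle. -/
lemma circPow_eq_zero_of_same_side {q q' : ℝ × ℝ × ℝ} {a c d e : Pt} (ha : circPow q a = 0)
    (hc : circPow q c = 0) (hd : circPow q d = 0) (ha' : circPow q' a = 0) (hc' : circPow q' c = 0)
    (he' : circPow q' e = 0) (hside : 0 < orient a c d * orient a c e)
    (he : 0 ≤ circPow q e) (hd' : 0 ≤ circPow q' d) : circPow q' d = 0 := by
  have h := circPow_sub_pencil ha hc ha' hc' d e
  rw [hd, he'] at h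
  have h1 : orient a c e * orient a c e * circPow q' d = -(orient a c d * orient a c e * circPow q e) := by
    linear_combination orient a c e * h
  have h2 : 0 < orient a c e * orient a c e := by
    have : orient a c e ≠ 0 := by rintro h0; simp [h0] at hside
    exact mul_self_pos.2 this
  nlinarith

/-- A point inside the circumcircle of `a c d` is inside the triangle or beyond exactly one
of its sides. -/
lemma inside_or_cross {q : ℝ × ℝ × ℝ} {a b c d : Pt} (ha : circPow q a = 0) (hc : circPow q c = 0)
    (hd : circPow q d = 0) (hb : circPow q b < 0) (h0 : orient a c d ≠ 0) (h1 : orient b c d ≠ 0)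
    (h2 : orient a b d ≠ 0) (h3 : orient a c b ≠ 0) :
    (0 < orient a c d * orient b c d ∧ 0 < orient a c d * orient a b d ∧
      0 < orient a c d * orient a c b) ∨
    Cross a b c d ∨ Cross c b a d ∨ Cross d b a c := by
  have hsum : orient a c d = orient b c d + orient a b d + orient a c b := by
    unfold orient; ring
  have hsq : 0 < orient a c d * orient a c d := mul_self_pos.2 h0
  have ea := circPow_bary q b c d a
  have ec := circPow_bary q a b d c
  have ed := circPow_bary q a c b d
  rw [ha, hc, hd] at ea ec ed
  have r1 : orient b a d = -orient a b d := orient_swap a b d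
  have r2 : orient b c a = -orient a c b := by unfold orient; ring
  have r3 : orient c b d = -orient b c d := orient_swap b c d
  have r4 : orient a b c = -orient a c b := by unfold orient; ring
  have r5 : orient d c b = -orient b c d := by unfold orient; ring
  have r6 : orient a d b = -orient a b d := by unfold orient; ring
  have r7 : orient c d a = orient a c d := by unfold orient; ring
  have r8 : orient c d b = orient b c d := by unfold orient; ring
  have r9 : orient a d c = -orient a c d := by unfold orient; ring
  rw [r1, r2] at ea
  rw [r3, r4] at ec
  rw [r5, r6] at ed
  have two : ∀ k m n B D₁ D₂ D₃ : ℝ, 0 < k * k → B < 0 → 0 ≤ D₁ → 0 ≤ D₂ → 0 ≤ D₃ →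
      0 = k * (B - D₁) + -m * (0 - D₂) + -n * (0 - D₃) → k * m < 0 → k * n < 0 → False := by
    intro k m n B D₁ D₂ D₃ hk hB h₁ h₂ h₃ h hm hn
    have : 0 = k * k * (B - D₁) + k * m * D₂ + k * n * D₃ := by linear_combination k * h
    nlinarith
  unfold Cross
  rw [r4, r7, r8, r9, r6, r3, show orient c b a = orient a c b by unfold orient; ring,
    show orient d b a = orient a d b by unfold orient; ring, r6,
    show orient d b c = orient b c d by unfold orient; ring]
  have n1 : ¬ (orient a c d * orient a b d < 0 ∧ orient a c d * orient a c b < 0) := fun h =>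
    two _ _ _ _ _ _ _ hsq hb (dsq_nonneg b a) (dsq_nonneg c a) (dsq_nonneg d a)
      (by linarith) h.1 h.2
  have n2 : ¬ (orient a c d * orient b c d < 0 ∧ orient a c d * orient a c b < 0) := fun h =>
    two _ _ _ _ _ _ _ hsq hb (dsq_nonneg b c) (dsq_nonneg a c) (dsq_nonneg d c)
      (by linarith) h.1 h.2
  have n3 : ¬ (orient a c d * orient b c d < 0 ∧ orient a c d * orient a b d < 0) := fun h =>
    two _ _ _ _ _ _ _ hsq hb (dsq_nonneg b d) (dsq_nonneg a d) (dsq_nonneg c d)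
      (by linarith) h.1 h.2
  clear ea ec ed two hsum hsq
  generalize orient a c d = k at *
  generalize orient b c d = l at *
  generalize orient a b d = m at *
  generalize orient a c b = n at *
  simp only [mul_pos_iff, mul_neg_iff, neg_pos, neg_lt_zero] at *
  rcases lt_or_gt_of_ne h0 with i | i <;> rcases lt_or_gt_of_ne h1 with j | j <;>
    rcases lt_or_gt_of_ne h2 with k | k <;> rcases lt_or_gt_of_ne h3 with l | l <;>
    simp_all [not_lt_of_gt]

/-- If `b` is the only point of `P` inside a circle `q₁` through `a, c`, and `a` is the only
point of `P` inside a circle `q₂` through `b, c`, then the circle through `a, b, c` has no point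
of `P` inside. -/
lemma exists_empty_circle {P : Set Pt} {q₁ q₂ : ℝ × ℝ × ℝ} {a b c : Pt}
    (h0 : orient a b c ≠ 0) (ha : circPow q₁ a = 0) (hc : circPow q₁ c = 0)
    (hb : circPow q₁ b < 0) (hb' : circPow q₂ b = 0) (hc' : circPow q₂ c = 0)
    (ha' : circPow q₂ a < 0)
    (h₁ : ∀ y ∈ P, y ≠ b → 0 ≤ circPow q₁ y) (h₂ : ∀ y ∈ P, y ≠ a → 0 ≤ circPow q₂ y) :
    ∃ q, circPow q a = 0 ∧ circPow q b = 0 ∧ circPow q c = 0 ∧ ∀ y ∈ P, 0 ≤ circPow q y := by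
  have r₁ : orient a c b = -orient a b c := orient_swap_right a b c
  obtain ⟨q, hq⟩ : ∃ q : ℝ × ℝ × ℝ, ∀ y, circPow q y =
      circPow q₁ y + circPow q₁ b / orient a b c * orient a c y := by
    refine ⟨⟨q₁.1 - circPow q₁ b / orient a b c * (c 1 - a 1),
      q₁.2.1 + circPow q₁ b / orient a b c * (c 0 - a 0),
      q₁.2.2 + circPow q₁ b / orient a b c * ((c 1 - a 1) * a 0 - (c 0 - a 0) * a 1)⟩, ?_⟩
    intro y
    generalize circPow q₁ b / orient a b c = k
    unfold circPow aff orient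
    ring
  have qa : circPow q a = 0 := by rw [hq, ha]; unfold orient; ring
  have qc : circPow q c = 0 := by rw [hq, hc]; unfold orient; ring
  have qb : circPow q b = 0 := by rw [hq, r₁]; field_simp; ring
  refine ⟨q, qa, qb, qc, fun y hy => ?_⟩
  by_contra! hneg
  have y₁ : 0 ≤ circPow q₁ y := h₁ y hy (by rintro rfl; linarith)
  have y₂ : 0 ≤ circPow q₂ y := h₂ y hy (by rintro rfl; linarith)
  have e₁ := circPow_sub_pencil ha hc qa qc b y
  have e₂ := circPow_sub_pencil hb' hc' qb qc a y
  have e₃ := circPow_bary q a b y c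
  rw [r₁, qb] at e₁
  rw [orient_rotate, qa] at e₂
  rw [qa, qb, qc, orient_swap b c y] at e₃
  have hsq : 0 < orient a b c * orient a b c := mul_self_pos.2 h0
  have s₁ : 0 < orient a b c * orient a c y := by
    have : orient a b c * orient a c y * circPow q₁ b =
        -(orient a b c * orient a b c) * (circPow q₁ y - circPow q y) := by
      linear_combination (-orient a b c) * e₁
    nlinarith
  have s₂ : orient a b c * orient b c y < 0 := by
    have : orient a b c * orient b c y * circPow q₂ a =
        (orient a b c * orient a b c) * (circPow q₂ y - circPow q y) := by
      linear_combination (-orient a b c) * e₂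
    nlinarith
  have : 0 = orient a b c * orient b c y * dsq a c - orient a b c * orient a c y * dsq b c +
      orient a b c * orient a b c * (circPow q y - dsq y c) := by
    linear_combination orient a b c * e₃
  nlinarith [dsq_nonneg a c, dsq_nonneg b c, dsq_nonneg y c]

/-! ### General position and order-`k` triangles -/

lemma GenPos.orient_ne_zero {P : Set Pt} (hP : GenPos P) {a b c : Pt} (ha : a ∈ P) (hb : b ∈ P)
    (hc : c ∈ P) (hab : a ≠ b) (hac : a ≠ c) (hbc : b ≠ c) : orient a b c ≠ 0 := by
  intro h
  apply hP.1 a b c ha hb hc hab hac hbc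
  have hN : dsq b a ≠ 0 := by
    intro h0
    apply hab
    unfold dsq at h0
    ext i
    fin_cases i <;> simp <;> nlinarith [sq_nonneg (b 0 - a 0), sq_nonneg (b 1 - a 1)]
  rw [collinear_iff_of_mem (p₀ := a) (by simp)]
  refine ⟨b - a, ?_⟩
  simp only [mem_insert_iff, mem_singleton_iff, forall_eq_or_imp, forall_eq]
  refine ⟨⟨0, by simp⟩, ⟨1, by simp⟩,
    ⟨((b 0 - a 0) * (c 0 - a 0) + (b 1 - a 1) * (c 1 - a 1)) / dsq b a, ?_⟩⟩
  unfold orient at h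
  ext i
  fin_cases i <;> simp <;> field_simp <;> unfold dsq
  · linear_combination (-(b 1 - a 1)) * h
  · linear_combination (b 0 - a 0) * h

lemma GenPos.not_concyclic {P : Set Pt} (hP : GenPos P) {a b c d : Pt} (ha : a ∈ P) (hb : b ∈ P)
    (hc : c ∈ P) (hd : d ∈ P) (hab : a ≠ b) (hac : a ≠ c) (had : a ≠ d) (hbc : b ≠ c)
    (hbd : b ≠ d) (hcd : c ≠ d) {q : ℝ × ℝ × ℝ} (qa : circPow q a = 0) (qb : circPow q b = 0)
    (qc : circPow q c = 0) (qd : circPow q d = 0) : False := by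
  refine hP.2 a b c d ha hb hc hd hab hac had hbc hbd hcd
    ⟨!₂[-q.1 / 2, -q.2.1 / 2], √(q.1 ^ 2 / 4 + q.2.1 ^ 2 / 4 - q.2.2), ?_⟩
  have key : ∀ p : Pt, circPow q p = 0 → dist p !₂[-q.1 / 2, -q.2.1 / 2] =
      √(q.1 ^ 2 / 4 + q.2.1 ^ 2 / 4 - q.2.2) := by
    intro p hp
    rw [EuclideanSpace.dist_eq]
    congr 1
    simp only [Fin.sum_univ_two, Real.dist_eq, sq_abs]
    unfold circPow aff at hp
    simp
    linear_combination hp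
  simp only [mem_insert_iff, mem_singleton_iff, forall_eq_or_imp, forall_eq]
  exact ⟨key a qa, key b qb, key c qc, key d qd⟩

lemma OrderKTri.exists_circPow {P : Set Pt} {t : Finset Pt} (ht : t.Nonempty)
    (h : OrderKTri P 1 t) :
    ∃ q, (∀ p ∈ t, circPow q p = 0) ∧
      ∀ y ∈ P, ∀ z ∈ P, circPow q y < 0 → circPow q z < 0 → y = z := by
  obtain ⟨z, r, hr, hcard⟩ := h
  obtain ⟨p₀, hp₀⟩ := ht
  have r0 : 0 ≤ r := hr p₀ hp₀ ▸ dist_nonneg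
  have key : ∀ p : Pt, circPow (-2 * z 0, -2 * z 1, z 0 ^ 2 + z 1 ^ 2 - r ^ 2) p =
      dist p z ^ 2 - r ^ 2 := by
    intro p
    rw [EuclideanSpace.dist_eq, Real.sq_sqrt (by positivity)]
    simp only [Fin.sum_univ_two, Real.dist_eq, sq_abs]
    unfold circPow aff
    ring
  have key' : ∀ p : Pt, circPow (-2 * z 0, -2 * z 1, z 0 ^ 2 + z 1 ^ 2 - r ^ 2) p < 0 →
      dist p z < r := by
    intro p hp
    rw [key] at hp
    exact lt_of_pow_lt_pow_left₀ 2 r0 (by linarith)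
  refine ⟨_, fun p hp => by rw [key, hr p hp, sub_self], fun y hy w hw hy' hw' => ?_⟩
  have hcard' : {p ∈ P | dist p z < r}.encard ≤ 1 := by exact_mod_cast hcard
  exact Set.encard_le_one_iff.1 hcard' y w ⟨hy, key' y hy'⟩ ⟨hw, key' w hw'⟩

/-! ### Separation of triangles -/

/-- Some nonconstant affine function is nonnegative on `t` and nonpositive on `s`. -/
def Separated (t s : Finset Pt) : Prop :=
  ∃ h : ℝ × ℝ × ℝ, (h.1 ≠ 0 ∨ h.2.1 ≠ 0) ∧ (∀ p ∈ t, 0 ≤ aff h p) ∧ ∀ p ∈ s, aff h p ≤ 0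

lemma aff_neg (h : ℝ × ℝ × ℝ) (y : Pt) : aff (-h) y = -aff h y := by
  simp [aff]; ring

lemma aff_combo (h : ℝ × ℝ × ℝ) (x y : Pt) {a b : ℝ} (hab : a + b = 1) :
    aff h (a • x + b • y) = a * aff h x + b * aff h y := by
  simp [aff]; linear_combination (-h.2.2) * hab

lemma aff_nonneg_of_mem_triSet {h : ℝ × ℝ × ℝ} {t : Finset Pt} (ht : ∀ p ∈ t, 0 ≤ aff h p)
    {y : Pt} (hy : y ∈ triSet t) : 0 ≤ aff h y := by
  have hconv : Convex ℝ {y | 0 ≤ aff h y} := by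
    intro x hx y hy a b ha hb hab
    simp only [mem_ofPred_eq] at *
    rw [aff_combo h x y hab]
    positivity
  exact convexHull_min (fun p hp => ht p hp) hconv hy

lemma aff_nonpos_of_mem_triSet {h : ℝ × ℝ × ℝ} {t : Finset Pt} (ht : ∀ p ∈ t, aff h p ≤ 0)
    {y : Pt} (hy : y ∈ triSet t) : aff h y ≤ 0 := by
  have := aff_nonneg_of_mem_triSet (h := -h) (t := t)
    (fun p hp => by rw [aff_neg]; linarith [ht p hp]) hy
  rw [aff_neg] at this
  linarith

/-- An affine function vanishing at three noncollinear points is constant. -/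
lemma aff_const_of_zero {h : ℝ × ℝ × ℝ} {a b c : Pt} (h0 : orient a b c ≠ 0)
    (ha : aff h a = 0) (hb : aff h b = 0) (hc : aff h c = 0) : h.1 = 0 ∧ h.2.1 = 0 := by
  unfold aff at *
  constructor
  · refine (mul_eq_zero.1 (?_ : orient a b c * _ = 0)).resolve_left h0
    unfold orient
    linear_combination (b 1 - c 1) * ha + (c 1 - a 1) * hb + (a 1 - b 1) * hc
  · refine (mul_eq_zero.1 (?_ : orient a b c * _ = 0)).resolve_left h0
    unfold orient
    linear_combination (c 0 - b 0) * ha + (a 0 - c 0) * hb + (b 0 - a 0) * hc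

lemma Separated.interior_inter_triSet {t s : Finset Pt} (h : Separated t s) :
    interior (triSet t) ∩ triSet s = ∅ := by
  obtain ⟨h, h0, ht, hs⟩ := h
  rw [Set.eq_empty_iff_forall_notMem]
  rintro y ⟨hyt, hys⟩
  have hy0 := aff_nonpos_of_mem_triSet hs hys
  set v : Pt := !₂[h.1, h.2.1]
  have hcont : Filter.Tendsto (fun e : ℝ => y - e • v) (nhdsWithin 0 (Ioi 0)) (nhds y) := by
    have : Continuous (fun e : ℝ => y - e • v) := by fun_prop
    have h1 := this.tendsto 0
    simp only [zero_smul, sub_zero] at h1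
    exact h1.mono_left nhdsWithin_le_nhds
  have hev := hcont.eventually (isOpen_interior.mem_nhds hyt)
  obtain ⟨e, he, he0⟩ := (hev.and self_mem_nhdsWithin).exists
  have h1 := aff_nonneg_of_mem_triSet ht (interior_subset he)
  have h2 : aff h (y - e • v) = aff h y - e * (h.1 ^ 2 + h.2.1 ^ 2) := by
    simp [aff, v]; ring
  have h3 : 0 < h.1 ^ 2 + h.2.1 ^ 2 := by
    rcases h0 with h0 | h0 <;> positivity
  have he0' : 0 < e := he0
  nlinarith [mul_pos he0' h3]

lemma interior_triSet_nonempty {a b c : Pt} (h0 : ¬ Collinear ℝ ({a, b, c} : Set Pt)) :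
    (interior (triSet {a, b, c})).Nonempty := by
  unfold triSet
  rw [interior_convexHull_nonempty_iff_affineSpan_eq_top]
  have hai := affineIndependent_iff_not_collinear_set.2 h0
  have := hai.affineSpan_eq_top_iff_card_eq_finrank_add_one.2 (by simp)
  have hset : (({a, b, c} : Finset Pt) : Set Pt) = range ![a, b, c] := by
    ext x
    simp [eq_comm]
    tauto
  rw [hset]
  exact this

lemma GenPos.interior_nonempty {P : Set Pt} (hP : GenPos P) {t : Finset Pt} (hc : t.card = 3)
    (ht : (t : Set Pt) ⊆ P) : (interior (triSet t)).Nonempty := by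
  obtain ⟨a, b, c, hab, hac, hbc, rfl⟩ := Finset.card_eq_three.1 hc
  exact interior_triSet_nonempty
    (hP.1 a b c (ht (by simp)) (ht (by simp)) (ht (by simp)) hab hac hbc)

lemma triSet_subset_closure_interior {t : Finset Pt} (h : (interior (triSet t)).Nonempty) :
    triSet t ⊆ closure (interior (triSet t)) := by
  unfold triSet at *
  rw [(convex_convexHull ℝ (t : Set Pt)).closure_interior_eq_closure_of_nonempty_interior h]
  exact subset_closure

lemma sep_of_interior_disjoint {t s : Finset Pt} (ht : (interior (triSet t)).Nonempty)
    (hs : (interior (triSet s)).Nonempty)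
    (h : interior (triSet t) ∩ interior (triSet s) = ∅) : Separated t s := by
  obtain ⟨f, u, hft, hfs⟩ := geometric_hahn_banach_open_open
    (convex_convexHull ℝ (t : Set Pt)).interior isOpen_interior
    (convex_convexHull ℝ (s : Set Pt)).interior isOpen_interior
    (Set.disjoint_iff_inter_eq_empty.2 h)
  have hf : ∀ y : Pt, aff (-f !₂[1, 0], -f !₂[0, 1], u) y = u - f y := by
    intro y
    have : y = y 0 • !₂[(1 : ℝ), 0] + y 1 • !₂[(0 : ℝ), 1] := by
      ext i; fin_cases i <;> simp
    conv_rhs => rw [this]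
    simp [aff]; ring
  refine ⟨(-f !₂[1, 0], -f !₂[0, 1], u), ?_, fun p hp => ?_, fun p hp => ?_⟩
  · by_contra! hn
    obtain ⟨x, hx⟩ := ht
    obtain ⟨y, hy⟩ := hs
    have h1 := hft x hx
    have h2 := hfs y hy
    have h3 := hf x
    have h4 := hf y
    unfold aff at h3 h4
    rw [hn.1, hn.2] at h3 h4
    linarith
  · rw [hf]
    have hmem := triSet_subset_closure_interior ht (subset_convexHull ℝ _ hp)
    have hcl : IsClosed {y | f y ≤ u} := isClosed_le f.continuous continuous_const
    have : f p ≤ u := closure_minimal (fun y hy => (hft y hy).le) hcl hmem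
    linarith
  · rw [hf]
    have hmem := triSet_subset_closure_interior hs (subset_convexHull ℝ _ hp)
    have hcl : IsClosed {y | u ≤ f y} := isClosed_le continuous_const f.continuous
    have : u ≤ f p := closure_minimal (fun y hy => (hfs y hy).le) hcl hmem
    linarith

/-! ### Neighbouring triangles in a triangulation -/

lemma exists_weights_of_mem_triSet {s : Finset Pt} {y : Pt} (hy : y ∈ triSet s) :
    ∃ w : Pt → ℝ, (∀ x ∈ s, 0 ≤ w x) ∧ ∑ x ∈ s, w x = 1 ∧
      ∀ h, aff h y = ∑ x ∈ s, w x * aff h x := by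
  obtain ⟨w, h0, h1, rfl⟩ := Finset.mem_convexHull'.1 hy
  refine ⟨w, h0, h1, fun h => ?_⟩
  have e : ∀ i : Fin 2, (∑ x ∈ s, w x • x) i = ∑ x ∈ s, w x * x i := by
    intro i
    simp
  unfold aff
  rw [e, e]
  simp only [mul_add, Finset.sum_add_distrib, Finset.mul_sum]
  rw [← Finset.sum_mul, h1, one_mul]
  congr 2 <;> exact Finset.sum_congr rfl fun _ _ => by ring

lemma IsTriangulation.card_eq {P : Set Pt} {T : Set (Finset Pt)} (hT : IsTriangulation P T)
    {t : Finset Pt} (ht : t ∈ T) : t.card = 3 := (hT.2.1 t ht).1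

lemma IsTriangulation.subset {P : Set Pt} {T : Set (Finset Pt)} (hT : IsTriangulation P T)
    {t : Finset Pt} (ht : t ∈ T) : (t : Set Pt) ⊆ P := (hT.2.1 t ht).2

lemma IsTriangulation.separated {P : Set Pt} {T : Set (Finset Pt)} (hP : GenPos P)
    (hT : IsTriangulation P T) {t s : Finset Pt} (ht : t ∈ T) (hs : s ∈ T) (hne : t ≠ s) :
    Separated t s :=
  sep_of_interior_disjoint (hP.interior_nonempty (hT.card_eq ht) (hT.subset ht))
    (hP.interior_nonempty (hT.card_eq hs) (hT.subset hs)) (hT.2.2.2.1 ht hs hne)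

lemma exists_adjacent {P : Set Pt} {T : Set (Finset Pt)} (hP : GenPos P)
    (hT : IsTriangulation P T) {a b c d : Pt} (ht : {a, c, d} ∈ T) (hb : b ∈ P)
    (hopp : orient c d a * orient c d b < 0) :
    ∃ x ∈ P, {c, d, x} ∈ T ∧ orient c d x * orient c d a < 0 := by
  have hc : c ∈ P := hT.subset ht (by simp)
  have hd : d ∈ P := hT.subset ht (by simp)
  have hcd : c ≠ d := by
    rintro rfl
    simp [orient] at hopp
  -- the affine function `g` vanishes on the line `c d` and is positive at `a`
  obtain ⟨g, hg⟩ : ∃ g : ℝ × ℝ × ℝ, ∀ y, aff g y = orient c d a * orient c d y :=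
    ⟨⟨orient c d a * -(d 1 - c 1), orient c d a * (d 0 - c 0),
      orient c d a * (-(d 0 - c 0) * c 1 + (d 1 - c 1) * c 0)⟩, fun y => by
        unfold aff
        generalize orient c d a = k
        unfold orient
        ring⟩
  have gc : aff g c = 0 := by rw [hg, show orient c d c = 0 by unfold orient; ring, mul_zero]
  have gd : aff g d = 0 := by rw [hg, show orient c d d = 0 by unfold orient; ring, mul_zero]
  have ga : 0 < aff g a := by
    rw [hg]
    exact mul_self_pos.2 (by rintro h; simp [h] at hopp)
  have gb : aff g b < 0 := by rw [hg]; exact hopp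
  set m : Pt := (1 / 2 : ℝ) • c + (1 / 2 : ℝ) • d with hm
  have am : ∀ h, aff h m = (aff h c + aff h d) / 2 := by
    intro h
    rw [hm, aff_combo h c d (by norm_num)]
    ring
  have hmem : m ∈ closure (⋃ s ∈ T, triSet s ∩ {y | aff g y < 0}) := by
    have hcont : Filter.Tendsto (fun e : ℝ => (1 - e) • m + e • b) (nhdsWithin 0 (Ioi 0))
        (nhds m) := by
      have : Continuous (fun e : ℝ => (1 - e) • m + e • b) := by fun_prop
      have h1 := this.tendsto 0
      simp only [zero_smul, sub_zero, one_smul, add_zero] at h1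
      exact h1.mono_left nhdsWithin_le_nhds
    refine mem_closure_of_tendsto hcont ?_
    filter_upwards [Ioc_mem_nhdsGT (zero_lt_one' ℝ)] with e he
    have hmP : m ∈ convexHull ℝ P :=
      convex_convexHull ℝ P (subset_convexHull ℝ P hc) (subset_convexHull ℝ P hd)
        (by norm_num) (by norm_num) (by norm_num)
    have hyP : (1 - e) • m + e • b ∈ convexHull ℝ P :=
      convex_convexHull ℝ P hmP (subset_convexHull ℝ P hb) (by linarith [he.2]) he.1.le (by ring)
    rw [← hT.2.2.2.2] at hyP
    simp only [mem_iUnion, exists_prop] at hyP ⊢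
    obtain ⟨s, hs, hys⟩ := hyP
    refine ⟨s, hs, hys, ?_⟩
    change aff g _ < 0
    rw [aff_combo g m b (by ring), am, gc, gd]
    nlinarith [he.1]
  rw [hT.1.closure_biUnion] at hmem
  simp only [mem_iUnion, exists_prop] at hmem
  obtain ⟨s, hs, hms⟩ := hmem
  obtain ⟨y, hys, hy⟩ := closure_nonempty_iff.1 ⟨m, hms⟩
  have hy : aff g y < 0 := hy
  have hms : m ∈ triSet s :=
    closure_minimal inter_subset_left (s.finite_toSet.isClosed_convexHull (𝕜 := ℝ)) hms
  have hst : {a, c, d} ≠ s := by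
    rintro rfl
    have := aff_nonneg_of_mem_triSet (h := g) (fun p hp => by
      simp only [Finset.mem_insert, Finset.mem_singleton] at hp
      rcases hp with rfl | rfl | rfl <;> linarith) hys
    linarith
  obtain ⟨h, h0, ht0, hs0⟩ := hT.separated hP ht hs hst
  have hm0 := aff_nonpos_of_mem_triSet hs0 hms
  have hc0 : aff h c = 0 := by
    linarith [am h, ht0 c (by simp), ht0 d (by simp)]
  have hd0 : aff h d = 0 := by
    linarith [am h, ht0 c (by simp), ht0 d (by simp)]
  obtain ⟨w, hw, hw1, hwm⟩ := exists_weights_of_mem_triSet hms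
  have hzero : ∀ x ∈ s, w x * aff h x = 0 := by
    refine (Finset.sum_eq_zero_iff_of_nonpos fun x hx =>
      mul_nonpos_of_nonneg_of_nonpos (hw x hx) (hs0 x hx)).1 ?_
    rw [← hwm, am, hc0, hd0]
    norm_num
  have hsupp : ∀ x ∈ s, w x = 0 ∨ x = c ∨ x = d := by
    intro x hx
    rcases mul_eq_zero.1 (hzero x hx) with h1 | h1
    · exact Or.inl h1
    · by_contra! hn
      have := aff_const_of_zero (hP.orient_ne_zero hc hd (hT.subset hs hx) hcd
        (Ne.symm hn.2.1) (Ne.symm hn.2.2)) hc0 hd0 h1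
      rcases h0 with h0 | h0
      · exact h0 this.1
      · exact h0 this.2
  have hends : ∀ e f : Pt, e ≠ f → (e = c ∧ f = d ∨ e = d ∧ f = c) → e ∈ s := by
    intro e f hef hcase
    by_contra hes
    have hzero' : ∀ l, aff l f = 0 → aff l m = 0 := by
      intro l hl
      rw [hwm]
      refine Finset.sum_eq_zero fun x hx => ?_
      have hxe : x ≠ e := by rintro rfl; exact hes hx
      rcases hsupp x hx with h1 | h1
      · rw [h1, zero_mul]
      · have : x = f := by
          rcases hcase with ⟨rfl, rfl⟩ | ⟨rfl, rfl⟩ <;> tauto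
        rw [this, hl, mul_zero]
    have hl : ∀ l, aff l f = 0 → aff l e = 0 := by
      intro l hl
      have := hzero' l hl
      rw [am] at this
      rcases hcase with ⟨rfl, rfl⟩ | ⟨rfl, rfl⟩ <;> linarith
    apply hef
    have h1 := hl (1, 0, -f 0) (by simp [aff])
    have h2 := hl (0, 1, -f 1) (by simp [aff])
    simp only [aff] at h1 h2
    ext i
    fin_cases i <;> simp <;> linarith
  have hcs : c ∈ s := hends c d hcd (by tauto)
  have hds : d ∈ s := hends d c hcd.symm (by tauto)
  have hsub : ({c, d} : Finset Pt) ⊆ s := by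
    intro x hx
    simp only [Finset.mem_insert, Finset.mem_singleton] at hx
    rcases hx with rfl | rfl <;> assumption
  obtain ⟨x, hx⟩ : ∃ x, s \ {c, d} = {x} := by
    rw [← Finset.card_eq_one, Finset.card_sdiff_of_subset hsub, hT.card_eq hs,
      Finset.card_pair hcd]
  have hseq : s = {c, d, x} := by
    rw [← Finset.sdiff_union_of_subset hsub, hx]
    ext z
    simp only [Finset.mem_union, Finset.mem_insert, Finset.mem_singleton]
    tauto
  refine ⟨x, hT.subset hs (by simp [hseq]), hseq ▸ hs, ?_⟩
  by_contra! hn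
  have := aff_nonneg_of_mem_triSet (h := g) (t := s) (fun p hp => by
    rw [hseq] at hp
    simp only [Finset.mem_insert, Finset.mem_singleton] at hp
    rcases hp with rfl | rfl | rfl
    · exact gc.ge
    · exact gd.ge
    · rw [hg]; linarith) hys
  linarith

/-! ### Flips -/

lemma Cross.ne {a b c d : Pt} (h : Cross a b c d) :
    a ≠ b ∧ a ≠ c ∧ a ≠ d ∧ b ≠ c ∧ b ≠ d ∧ c ≠ d := by
  obtain ⟨h1, h2⟩ := h
  refine ⟨?_, ?_, ?_, ?_, ?_, ?_⟩ <;> rintro rfl <;>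
    simp [orient, mul_comm] at h1 h2

/-- For crossing segments the triangles `a b c` and `a c d` have opposite orientations. -/
lemma Cross.orient_mul_neg {a b c d : Pt} (h : Cross a b c d) :
    orient a b c * orient c d a < 0 := by
  obtain ⟨h1, h2⟩ := h
  have e : orient a b c - orient a b d = orient c d b - orient c d a := by unfold orient; ring
  rw [mul_neg_iff] at *
  rcases h1 with h1 | h1 <;> rcases h2 with h2 | h2
  · linarith
  · exact Or.inl ⟨h1.1, h2.1⟩
  · exact Or.inr ⟨h1.1, h2.1⟩
  · linarith

/-- If `b` is inside the circle `q` through `a, c, d` and `a b` crosses `c d`, then a circle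
through `b, c` cannot have `d` inside and `a` not inside. -/
lemma Cross.neg_of_neg {q q' : ℝ × ℝ × ℝ} {a b c d : Pt} (hX : Cross a b c d)
    (ha : circPow q a = 0) (hc : circPow q c = 0) (hd : circPow q d = 0) (hb : circPow q b < 0)
    (hb' : circPow q' b = 0) (hc' : circPow q' c = 0) (hd' : circPow q' d < 0) :
    circPow q' a < 0 := by
  by_contra! ha'
  have e := circPow_sub_bary q q' a b c d
  have r₁ : orient d b c = orient c d b := by unfold orient; ring
  have r₂ : orient a d c = -orient c d a := by unfold orient; ring
  rw [r₁, r₂, ha, hb', hc, hc', hd] at e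
  have h1 := hX.orient_mul_neg
  have h2 := hX.2
  rw [mul_neg_iff] at h1 h2
  rcases h1 with h1 | h1 <;> rcases h2 with h2 | h2
  · linarith
  · nlinarith [mul_nonneg h2.2.le ha', mul_pos_of_neg_of_neg h2.1 hb,
      mul_neg_of_pos_of_neg h1.1 hd']
  · nlinarith [mul_nonneg_of_nonpos_of_nonpos h2.2.le (neg_nonpos.2 ha'),
      mul_neg_of_pos_of_neg h2.1 hb, mul_pos_of_neg_of_neg h1.1 hd']
  · linarith

/-- The vertex set of an empty triangle: `t` has three elements in `P` and no point of `P` is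
inside the circumcircle. -/
def EmptyTri (P : Set Pt) (t : Finset Pt) : Prop :=
  t.card = 3 ∧ (t : Set Pt) ⊆ P ∧ ∃ q, (∀ p ∈ t, circPow q p = 0) ∧ ∀ y ∈ P, 0 ≤ circPow q y

/-- The segments `a b` and `c d` cross, and each of the circles through `a, c, d` and through
`b, c, d` has just one point of `P` inside, namely the fourth point. -/
def Flip (P : Set Pt) (a b c d : Pt) : Prop :=
  (a ∈ P ∧ b ∈ P ∧ c ∈ P ∧ d ∈ P) ∧ Cross a b c d ∧
    (∃ q, circPow q a = 0 ∧ circPow q c = 0 ∧ circPow q d = 0 ∧ circPow q b < 0 ∧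
      ∀ y ∈ P, y ≠ b → 0 ≤ circPow q y) ∧
    ∃ q, circPow q b = 0 ∧ circPow q c = 0 ∧ circPow q d = 0 ∧ circPow q a < 0 ∧
      ∀ y ∈ P, y ≠ a → 0 ≤ circPow q y

lemma Flip.swap_left {P : Set Pt} {a b c d : Pt} (h : Flip P a b c d) : Flip P b a c d := by
  obtain ⟨⟨ha, hb, hc, hd⟩, hX, h1, h2⟩ := h
  exact ⟨⟨hb, ha, hc, hd⟩, hX.swap_left, h2, h1⟩

lemma Flip.swap_right {P : Set Pt} {a b c d : Pt} (h : Flip P a b c d) : Flip P a b d c := by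
  obtain ⟨⟨ha, hb, hc, hd⟩, hX, ⟨q, h1, h2, h3, h4⟩, ⟨q', h1', h2', h3', h4'⟩⟩ := h
  exact ⟨⟨ha, hb, hd, hc⟩, hX.swap_right, ⟨q, h1, h3, h2, h4⟩, ⟨q', h1', h3', h2', h4'⟩⟩

lemma Flip.exists_circle {P : Set Pt} {a b c d : Pt} (h : Flip P a b c d) :
    ∃ q, circPow q a = 0 ∧ circPow q b = 0 ∧ circPow q c = 0 ∧ ∀ y ∈ P, 0 ≤ circPow q y := by
  obtain ⟨-, hX, ⟨q, h1, h2, h3, h4, h5⟩, ⟨q', h1', h2', h3', h4', h5'⟩⟩ := h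
  exact exists_empty_circle (by rintro h0; simpa [h0] using hX.1) h1 h2 h4 h1' h2' h4' h5 h5'

lemma Flip.emptyTri {P : Set Pt} {a b c d : Pt} (h : Flip P a b c d) :
    EmptyTri P (insert c {a, b}) := by
  obtain ⟨q, ha, hb, hc, hq⟩ := h.exists_circle
  obtain ⟨⟨aP, bP, cP, dP⟩, hX, -⟩ := h
  obtain ⟨h1, h2, h3, h4, h5, h6⟩ := hX.ne
  refine ⟨Finset.card_eq_three.2 ⟨c, a, b, h2.symm, h4.symm, h1, rfl⟩, ?_, q, ?_, hq⟩
  · intro x hx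
    simp only [Finset.coe_insert, Finset.coe_singleton, mem_insert_iff, mem_singleton_iff] at hx
    rcases hx with rfl | rfl | rfl <;> assumption
  · intro x hx
    simp only [Finset.mem_insert, Finset.mem_singleton] at hx
    rcases hx with rfl | rfl | rfl <;> assumption

lemma Flip.eq_of_same_edge {P : Set Pt} (hP : GenPos P) {a b c d e : Pt} (h : Flip P a b c d)
    (h' : Flip P a b c e) : d = e := by
  by_contra hne
  obtain ⟨q, ha, hb, hd, hq⟩ := h.swap_right.exists_circle
  obtain ⟨q', ha', hb', he', hq'⟩ := h'.swap_right.exists_circle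
  obtain ⟨⟨aP, bP, cP, dP⟩, hX, -⟩ := h
  obtain ⟨⟨-, -, -, eP⟩, hX', -⟩ := h'
  have hside : 0 < orient a b d * orient a b e := by
    have h1 := hX.1
    have h2 := hX'.1
    rw [mul_neg_iff] at h1 h2
    rw [mul_pos_iff]
    rcases h1 with h1 | h1 <;> rcases h2 with h2 | h2
    · exact Or.inr ⟨h1.2, h2.2⟩
    · linarith
    · linarith
    · exact Or.inl ⟨h1.2, h2.2⟩
  have := circPow_eq_zero_of_same_side ha hb hd ha' hb' he' hside (hq e eP) (hq' d dP)
  exact hP.not_concyclic aP bP dP eP hX.ne.1 hX.ne.2.2.1 hX'.ne.2.2.1 hX.ne.2.2.2.2.1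
    hX'.ne.2.2.2.2.1 hne ha' hb' this he'

/-- Two edges of one empty triangle cannot both be flipped. -/
lemma Flip.not_adjacent {P : Set Pt} (hP : GenPos P) {a b c d e : Pt} (h : Flip P a b c d)
    (h' : Flip P c b a e) : False := by
  obtain ⟨⟨aP, bP, cP, dP⟩, hX, ⟨q, ha, hc, hd, hb, hq⟩, -⟩ := h
  obtain ⟨⟨-, -, -, eP⟩, hX', ⟨q', hc', ha', he', hb', hq'⟩, -⟩ := h'
  have s := hX.orient_mul_neg
  have s' := hX'.orient_mul_neg
  rw [show orient c d a = orient a c d by unfold orient; ring] at s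
  rw [show orient c b a = -orient a b c by unfold orient; ring,
    show orient a e c = -orient a c e by unfold orient; ring] at s'
  have hside : 0 < orient a c d * orient a c e := by
    rw [mul_neg_iff] at s s'
    rw [mul_pos_iff]
    rcases s with s | s <;> rcases s' with s' | s'
    · linarith
    · exact Or.inr ⟨s.2, by linarith⟩
    · exact Or.inl ⟨s.2, by linarith⟩
    · linarith
  by_cases hde : d = e
  · subst hde
    have h1 := hX.1
    have h2 := hX'.2
    rw [show orient a d c = -orient a c d by unfold orient; ring,
      show orient a d b = -orient a b d by unfold orient; ring] at h2
    rw [mul_neg_iff] at s h1 h2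
    rcases s with s | s <;> rcases h1 with h1 | h1 <;> rcases h2 with h2 | h2 <;> linarith
  · have := circPow_eq_zero_of_same_side ha hc hd ha' hc' he' hside
      (hq e eP hX'.ne.2.2.2.2.1.symm) (hq' d dP hX.ne.2.2.2.2.1.symm)
    exact hP.not_concyclic aP cP dP eP hX.ne.2.1 hX.ne.2.2.1 hX'.ne.2.2.2.2.2
      hX.ne.2.2.2.2.2 hX'.ne.2.2.1 hde ha' hc' this he'

/-- Label of a flip: the removed edge together with the inserted edge. -/
def flipLabels (P : Set Pt) : Set (Finset Pt × Finset Pt) :=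
  {φ | ∃ a b c d, Flip P a b c d ∧ φ = ({a, b}, {c, d})}

lemma exists_flip_of_mem {P : Set Pt} {φ : Finset Pt × Finset Pt} (hφ : φ ∈ flipLabels P)
    {c : Pt} (hc : c ∈ φ.2) : ∃ a b d, Flip P a b c d ∧ φ = ({a, b}, {c, d}) := by
  obtain ⟨a, b, c', d, hF, rfl⟩ := hφ
  simp only [Finset.mem_insert, Finset.mem_singleton] at hc
  rcases hc with rfl | rfl
  · exact ⟨a, b, d, hF, rfl⟩
  · exact ⟨a, b, c', hF.swap_right, by rw [Finset.pair_comm c' c]⟩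

/-- A pair of distinct elements is determined by a triple containing it and the third element. -/
lemma pair_eq_of_insert_eq {c a b x y : Pt} (hab : a ≠ b) (hca : c ≠ a) (hcb : c ≠ b)
    (h : (insert c {a, b} : Finset Pt) = insert c {x, y}) : a = x ∧ b = y ∨ a = y ∧ b = x := by
  have ha : a ∈ (insert c {x, y} : Finset Pt) := h ▸ by simp
  have hb : b ∈ (insert c {x, y} : Finset Pt) := h ▸ by simp
  simp only [Finset.mem_insert, Finset.mem_singleton] at ha hb
  grind

lemma flipLabels_unique {P : Set Pt} (hP : GenPos P) {φ φ' : Finset Pt × Finset Pt}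
    (hφ : φ ∈ flipLabels P) (hφ' : φ' ∈ flipLabels P) {c c' : Pt} (hc : c ∈ φ.2)
    (hc' : c' ∈ φ'.2) (h : insert c φ.1 = insert c' φ'.1) : φ = φ' := by
  obtain ⟨a, b, d, hF, rfl⟩ := exists_flip_of_mem hφ hc
  obtain ⟨a', b', d', hF', rfl⟩ := exists_flip_of_mem hφ' hc'
  have n := hF.2.1.ne
  have n' := hF'.2.1.ne
  have key : ∀ a b d, Flip P a b c d → a ≠ b → a ≠ c → b ≠ c →
      (insert c {a, b} : Finset Pt) = insert c' {a', b'} → c' ≠ a := by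
    rintro a b d hF n1 n2 n3 h rfl
    rw [show (insert c {c', b} : Finset Pt) = insert c' {b, c} by
      ext; simp only [Finset.mem_insert, Finset.mem_singleton]; tauto] at h
    rcases pair_eq_of_insert_eq n3 n1 n2 h with
      ⟨rfl, rfl⟩ | ⟨rfl, rfl⟩
    · exact hF.not_adjacent hP hF'.swap_left
    · exact hF.not_adjacent hP hF'
  have hmem : c' ∈ (insert c {a, b} : Finset Pt) := by simp only at h; rw [h]; simp
  simp only [Finset.mem_insert, Finset.mem_singleton] at hmem
  rcases hmem with rfl | hmem | hmem
  · rcases pair_eq_of_insert_eq n.1 n.2.1.symm n.2.2.2.1.symm h with ⟨rfl, rfl⟩ | ⟨rfl, rfl⟩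
    · rw [hF.eq_of_same_edge hP hF']
    · rw [hF.eq_of_same_edge hP hF'.swap_left, Finset.pair_comm]
  · exact absurd hmem (key a b d hF n.1 n.2.1 n.2.2.2.1 h)
  · exact absurd hmem (key b a d hF.swap_left n.1.symm n.2.2.2.1 n.2.1
      (by rw [Finset.pair_comm b a]; exact h))

/-! ### Order-1 triangulations are obtained by flips -/

lemma IsTriangulation.exists_cross {P : Set Pt} {T : Set (Finset Pt)} (hP : GenPos P)
    (hT : IsTriangulation P T) {t : Finset Pt} (ht : t ∈ T) {q : ℝ × ℝ × ℝ}
    (hq : ∀ p ∈ t, circPow q p = 0) {b : Pt} (hbP : b ∈ P) (hb : circPow q b < 0) :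
    ∃ a c d, t = {a, c, d} ∧ Cross a b c d := by
  obtain ⟨a, c, d, hac, had, hcd, rfl⟩ := Finset.card_eq_three.1 (hT.card_eq ht)
  have hbt : b ∉ ({a, c, d} : Finset Pt) := fun h => hb.ne (hq b h)
  have aP : a ∈ P := hT.subset ht (by simp)
  have cP : c ∈ P := hT.subset ht (by simp)
  have dP : d ∈ P := hT.subset ht (by simp)
  simp only [Finset.mem_insert, Finset.mem_singleton, not_or] at hbt
  obtain ⟨hba, hbc, hbd⟩ := hbt
  have h0 := hP.orient_ne_zero aP cP dP hac had hcd
  rcases inside_or_cross (hq a (by simp)) (hq c (by simp)) (hq d (by simp)) hb h0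
    (hP.orient_ne_zero hbP cP dP hbc hbd hcd)
    (hP.orient_ne_zero aP hbP dP (Ne.symm hba) had hbd)
    (hP.orient_ne_zero aP cP hbP hac (Ne.symm hba) (Ne.symm hbc)) with h | h | h | h
  · exfalso
    obtain ⟨s, hs, hbs⟩ := hT.2.2.1 b hbP
    have hne : {a, c, d} ≠ s := by
      rintro rfl
      exact hb.ne (hq b hbs)
    obtain ⟨l, l0, lt, ls⟩ := hT.separated hP ht hs hne
    have la := lt a (by simp)
    have lc := lt c (by simp)
    have ld := lt d (by simp)
    have lb := ls b hbs
    have e : orient a c d * orient a c d * aff l b =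
        orient a c d * orient b c d * aff l a + orient a c d * orient a b d * aff l c +
          orient a c d * orient a c b * aff l d := by
      linear_combination orient a c d * aff_bary l a c d b
    have hsq : 0 < orient a c d * orient a c d := mul_self_pos.2 h0
    have e1 := mul_nonneg h.1.le la
    have e2 := mul_nonneg h.2.1.le lc
    have e3 := mul_nonneg h.2.2.le ld
    have e4 := mul_nonpos_of_nonneg_of_nonpos hsq.le lb
    have := aff_const_of_zero h0
      ((mul_eq_zero.1 (by linarith : orient a c d * orient b c d * aff l a = 0)).resolve_left
        h.1.ne')
      ((mul_eq_zero.1 (by linarith : orient a c d * orient a b d * aff l c = 0)).resolve_left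
        h.2.1.ne')
      ((mul_eq_zero.1 (by linarith : orient a c d * orient a c b * aff l d = 0)).resolve_left
        h.2.2.ne')
    tauto
  · exact ⟨a, c, d, rfl, h⟩
  · exact ⟨c, a, d, Finset.insert_comm _ _ _, h⟩
  · refine ⟨d, a, c, ?_, h⟩
    ext
    simp only [Finset.mem_insert, Finset.mem_singleton]
    tauto

/-- In an order-1 triangulation, a triangle with a point `b` inside its circumcircle is one half
of a flipped pair. -/
lemma IsTriangulation.exists_cross_neighbor {P : Set Pt} {T : Set (Finset Pt)} (hP : GenPos P)
    (hT : IsTriangulation P T) {q : Finset Pt → ℝ × ℝ × ℝ}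
    (hq : ∀ t ∈ T, ∀ p ∈ t, circPow (q t) p = 0)
    (hq₁ : ∀ t ∈ T, ∀ y ∈ P, ∀ z ∈ P, circPow (q t) y < 0 → circPow (q t) z < 0 → y = z)
    {b : Pt} (hb : b ∈ P) {t : Finset Pt} (ht : t ∈ T) (hbt : circPow (q t) b < 0) :
    ∃ a c d, t = {a, c, d} ∧ Cross a b c d ∧ {b, c, d} ∈ T := by
  by_contra hbad
  -- a counterexample with the smallest power of `b`
  obtain ⟨t, ⟨ht, hbt, hbad⟩, hmin⟩ := (hT.1.subset (fun s hs => hs.1 :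
      {s | s ∈ T ∧ circPow (q s) b < 0 ∧
        ¬ ∃ a c d, s = {a, c, d} ∧ Cross a b c d ∧ {b, c, d} ∈ T} ⊆ T)).exists_minimalFor
    (fun s => circPow (q s) b) _ ⟨t, ht, hbt, hbad⟩
  obtain ⟨a, c, d, rfl, hX⟩ := hT.exists_cross hP ht (hq t ht) hb hbt
  obtain ⟨x, hxP, hs, hx⟩ := exists_adjacent hP hT ht hb hX.2
  have aP : a ∈ P := hT.subset ht (by simp)
  have cP : c ∈ P := hT.subset ht (by simp)
  have dP : d ∈ P := hT.subset ht (by simp)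
  have hxb : x ≠ b := by
    rintro rfl
    refine hbad ⟨a, c, d, rfl, hX, ?_⟩
    convert hs using 1
    ext
    simp only [Finset.mem_insert, Finset.mem_singleton]
    tauto
  have ne := hX.ne
  have hxa : x ≠ a := by
    rintro rfl
    exact absurd hx (not_lt.2 (mul_self_nonneg _))
  have hxc : x ≠ c := by rintro rfl; simp [orient, mul_comm] at hx
  have hxd : x ≠ d := by rintro rfl; simp [orient, mul_comm] at hx
  have pa := hq _ ht a (by simp)
  have pc := hq _ ht c (by simp)
  have pd := hq _ ht d (by simp)
  have px : 0 < circPow (q {a, c, d}) x := by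
    refine lt_of_le_of_ne ?_ fun h0 => hP.not_concyclic aP cP dP hxP ne.2.1 ne.2.2.1 hxa.symm
      ne.2.2.2.2.2 hxc.symm hxd.symm pa pc pd h0.symm
    by_contra! hn
    exact hxb (hq₁ _ ht x hxP b hb hn hbt)
  have e := circPow_sub_pencil pc pd (hq _ hs c (by simp)) (hq _ hs d (by simp)) x b
  rw [hq _ hs x (by simp)] at e
  have hside : 0 < orient c d x * orient c d b := by
    have h1 := hX.2
    rw [mul_neg_iff] at h1 hx
    rw [mul_pos_iff]
    rcases h1 with h1 | h1 <;> rcases hx with hx | hx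
    · linarith
    · exact Or.inr ⟨hx.1, h1.2⟩
    · exact Or.inl ⟨hx.1, h1.2⟩
    · linarith
  have hlt : circPow (q {c, d, x}) b < circPow (q {a, c, d}) b := by
    rw [mul_pos_iff] at hside
    rcases hside with hside | hside <;> nlinarith
  by_cases hgood : ∃ a' c' d', ({c, d, x} : Finset Pt) = {a', c', d'} ∧ Cross a' b c' d' ∧
      {b, c', d'} ∈ T
  swap
  · exact absurd (hmin (j := {c, d, x}) ⟨hs, hlt.trans hbt, hgood⟩ hlt.le) (not_le.2 hlt)
  obtain ⟨a', c', d', hs', hX', hu⟩ := hgood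
  have ne' := hX'.ne
  have hqs : ∀ p ∈ ({a', c', d'} : Finset Pt), circPow (q {c, d, x}) p = 0 := by
    intro p hp
    exact hq _ hs p (hs' ▸ hp)
  have neg : circPow (q {b, c', d'}) a' < 0 :=
    circPow_neg_of_opposite (hqs c' (by simp)) (hqs d' (by simp)) (hqs a' (by simp))
      (hq _ hu c' (by simp)) (hq _ hu d' (by simp)) (hq _ hu b (by simp)) hX'.2
      (hlt.trans hbt)
  have hmem : ∀ p, p = c ∨ p = d ∨ p = x ↔ p = a' ∨ p = c' ∨ p = d' := by
    intro p
    have := congrArg (p ∈ ·) hs'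
    simpa using this
  have hother : ∀ p ∈ ({c, d, x} : Finset Pt), p ≠ a' → circPow (q {b, c', d'}) p = 0 := by
    intro p hp hpa
    rw [hs'] at hp
    refine hq _ hu p ?_
    simp only [Finset.mem_insert, Finset.mem_singleton] at hp ⊢
    tauto
  have hfinal : a' = c ∨ a' = d → circPow (q {b, c', d'}) a < 0 := by
    rintro (rfl | rfl)
    · exact hX.swap_right.neg_of_neg pa pd pc hbt (hq _ hu b (by simp))
        (hother d (by simp) ne.2.2.2.2.2.symm) neg
    · exact hX.neg_of_neg pa pc pd hbt (hq _ hu b (by simp))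
        (hother c (by simp) ne.2.2.2.2.2) neg
  have ha'P : a' ∈ P := hT.subset hs (by rw [hs']; simp)
  rcases (hmem a').2 (Or.inl rfl) with h | h | h
  · have := hq₁ _ hu a aP a' ha'P (hfinal (Or.inl h)) neg
    exact ne.2.1 (this.trans h)
  · have := hq₁ _ hu a aP a' ha'P (hfinal (Or.inr h)) neg
    exact ne.2.2.1 (this.trans h)
  · have hcd' : c' = c ∧ d' = d ∨ c' = d ∧ d' = c := by
      have h1 := (hmem c').2 (by tauto)
      have h2 := (hmem d').2 (by tauto)
      grind
    subst h
    have h1 := hX'.2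
    rcases hcd' with ⟨rfl, rfl⟩ | ⟨rfl, rfl⟩
    · linarith
    · rw [orient_swap d' c', orient_swap d' c'] at h1
      linarith

lemma IsOrderDT.emptyTri_or_flip {P : Set Pt} {T : Set (Finset Pt)} (hP : GenPos P)
    (hT : IsOrderDT P 1 T) {t : Finset Pt} (ht : t ∈ T) :
    EmptyTri P t ∨ ∃ a b c d, Flip P a b c d ∧ t = {a, c, d} ∧ {b, c, d} ∈ T := by
  obtain ⟨hT, hO⟩ := hT
  have hex : ∀ t, ∃ q, t ∈ T → (∀ p ∈ t, circPow q p = 0) ∧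
      ∀ y ∈ P, ∀ z ∈ P, circPow q y < 0 → circPow q z < 0 → y = z := by
    intro t
    by_cases ht : t ∈ T
    · obtain ⟨q, hq⟩ := (hO t ht).exists_circPow
        (Finset.card_pos.1 (by rw [hT.card_eq ht]; norm_num))
      exact ⟨q, fun _ => hq⟩
    · exact ⟨0, fun h => absurd h ht⟩
  choose q hq using hex
  by_cases hemp : ∀ y ∈ P, 0 ≤ circPow (q t) y
  · exact Or.inl ⟨hT.card_eq ht, hT.subset ht, q t, (hq t ht).1, hemp⟩
  push Not at hemp
  obtain ⟨b, hb, hbt⟩ := hemp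
  obtain ⟨a, c, d, rfl, hX, hu⟩ := hT.exists_cross_neighbor hP (fun t ht => (hq t ht).1)
    (fun t ht => (hq t ht).2) hb ht hbt
  have aP : a ∈ P := hT.subset ht (by simp)
  have cP : c ∈ P := hT.subset ht (by simp)
  have dP : d ∈ P := hT.subset ht (by simp)
  have h1 := (hq _ ht).1
  have h2 := (hq _ hu).1
  have neg : circPow (q {b, c, d}) a < 0 :=
    circPow_neg_of_opposite (h1 c (by simp)) (h1 d (by simp)) (h1 a (by simp))
      (h2 c (by simp)) (h2 d (by simp)) (h2 b (by simp)) hX.2 hbt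
  refine Or.inr ⟨a, b, c, d, ⟨⟨aP, hb, cP, dP⟩, hX,
    ⟨_, h1 a (by simp), h1 c (by simp), h1 d (by simp), hbt, fun y hy hyb => ?_⟩,
    ⟨_, h2 b (by simp), h2 c (by simp), h2 d (by simp), neg, fun y hy hya => ?_⟩⟩, rfl, hu⟩
  · by_contra! hn
    exact hyb ((hq _ ht).2 y hy b hb hn hbt)
  · by_contra! hn
    exact hya ((hq _ hu).2 y hy a aP hn neg)

lemma EmptyTri.separated {P : Set Pt} (hP : GenPos P) {t s : Finset Pt} (ht : EmptyTri P t)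
    (hs : EmptyTri P s) (hne : t ≠ s) : Separated t s := by
  obtain ⟨ct, tP, q, hq, hq0⟩ := ht
  obtain ⟨cs, sP, q', hq', hq0'⟩ := hs
  have hdiff : ∀ y, aff (q' - q) y = circPow q' y - circPow q y := by
    intro y
    simp [aff, circPow]
    ring
  refine ⟨q' - q, ?_, fun p hp => ?_, fun p hp => ?_⟩
  · by_contra! hz
    have hconst : ∀ y, circPow q' y - circPow q y = (q' - q).2.2 := by
      intro y
      rw [← hdiff, aff, hz.1, hz.2]
      ring
    obtain ⟨a, b, c, hab, hac, hbc, rfl⟩ := Finset.card_eq_three.1 ct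
    obtain ⟨d, hds, hdt⟩ := Finset.not_subset.1
      (fun h => hne (Finset.eq_of_subset_of_card_le h (by rw [cs, ct])).symm :
        ¬ s ⊆ {a, b, c})
    have qa := hq a (by simp)
    have aP : a ∈ P := tP (by simp)
    have dP : d ∈ P := sP hds
    have h1 := hconst a
    have h2 := hconst d
    have h3 := hq0' a aP
    have h4 := hq0 d dP
    have h5 := hq' d hds
    simp only [Finset.mem_insert, Finset.mem_singleton, not_or] at hdt
    exact hP.not_concyclic aP (tP (by simp)) (tP (by simp)) dP hab hac (Ne.symm hdt.1) hbc
      (Ne.symm hdt.2.1) (Ne.symm hdt.2.2) qa (hq b (by simp)) (hq c (by simp)) (by linarith)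
  · rw [hdiff, hq p hp, sub_zero]
    exact hq0' p (tP hp)
  · rw [hdiff, hq' p hp]
    linarith [hq0 p (sP hp)]

lemma IsTriangulation.subset_of_nonempty_subset {P : Set Pt} {T T' : Set (Finset Pt)}
    (hP : GenPos P) (hT : IsTriangulation P T) (hT' : IsTriangulation P T')
    (h : ∀ t ∈ T, ¬ EmptyTri P t → t ∈ T') (h' : ∀ t ∈ T', ¬ EmptyTri P t → t ∈ T) :
    T ⊆ T' := by
  intro t ht
  by_contra ht'
  have hemp : EmptyTri P t := by
    by_contra hn
    exact ht' (h t ht hn)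
  obtain ⟨y, hy⟩ := hP.interior_nonempty (hT.card_eq ht) (hT.subset ht)
  have hyP : y ∈ convexHull ℝ P := convexHull_mono (hT.subset ht) (interior_subset hy)
  rw [← hT'.2.2.2.2] at hyP
  simp only [mem_iUnion, exists_prop] at hyP
  obtain ⟨s, hs, hys⟩ := hyP
  have hts : t ≠ s := by
    rintro rfl
    exact ht' hs
  have hsep : Separated t s := by
    by_cases hse : EmptyTri P s
    · exact hemp.separated hP hse hts
    · exact hT.separated hP ht (h' s hs hse) hts
  have : y ∈ interior (triSet t) ∩ triSet s := ⟨hy, hys⟩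
  rw [hsep.interior_inter_triSet] at this
  exact this

/-- The flips carried out in `T`. -/
def flipsOf (P : Set Pt) (T : Set (Finset Pt)) : Set (Finset Pt × Finset Pt) :=
  {φ ∈ flipLabels P | ∀ p ∈ φ.1, insert p φ.2 ∈ T}

lemma flipsOf_injOn {P : Set Pt} (hP : GenPos P) :
    InjOn (flipsOf P) {T | IsOrderDT P 1 T} := by
  have key : ∀ T T', IsOrderDT P 1 T → flipsOf P T = flipsOf P T' →
      ∀ t ∈ T, ¬ EmptyTri P t → t ∈ T' := by
    intro T T' hT h t ht hemp
    obtain ⟨a, b, c, d, hF, rfl, hu⟩ := (hT.emptyTri_or_flip hP ht).resolve_left hemp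
    have hmem : (({a, b}, {c, d}) : Finset Pt × Finset Pt) ∈ flipsOf P T := by
      refine ⟨⟨a, b, c, d, hF, rfl⟩, fun p hp => ?_⟩
      simp only [Finset.mem_insert, Finset.mem_singleton] at hp
      rcases hp with rfl | rfl
      · exact ht
      · exact hu
    rw [h] at hmem
    exact hmem.2 a (by simp)
  intro T hT T' hT' h
  exact Subset.antisymm
    (hT.1.subset_of_nonempty_subset hP hT'.1 (key T T' hT h) (key T' T hT' h.symm))
    (hT'.1.subset_of_nonempty_subset hP hT.1 (key T' T hT' h.symm) (key T T' hT h))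

/-! ### Counting separated triangles -/

/-- A linear functional `y ↦ y₀ + s y₁` that is injective on a given finite set. -/
lemma exists_injOn_shear (P : Finset Pt) :
    ∃ s : ℝ, ∀ p ∈ P, ∀ q ∈ P, p 0 + s * p 1 = q 0 + s * q 1 → p = q := by
  obtain ⟨s, hs⟩ := Infinite.exists_notMem_finset
    ((P ×ˢ P).image fun x => -(x.1 0 - x.2 0) / (x.1 1 - x.2 1))
  refine ⟨s, fun p hp q hq h => ?_⟩
  by_cases h1 : p 1 = q 1
  · ext i
    fin_cases i
    · simp only [Fin.zero_eta]
      rw [h1] at h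
      linarith
    · exact h1
  · refine absurd (Finset.mem_image.2 ⟨(p, q), Finset.mk_mem_product hp hq, ?_⟩) hs
    have : p 1 - q 1 ≠ 0 := sub_ne_zero.2 h1
    field_simp
    linarith

lemma exists_sorted {f : Pt → ℝ} {t : Finset Pt} (ht : t.card = 3) (hf : InjOn f t) :
    ∃ l m r, t = {l, m, r} ∧ f l < f m ∧ f m < f r := by
  obtain ⟨l, hl, hl'⟩ := t.exists_min_image f (Finset.card_pos.1 (by rw [ht]; norm_num))
  obtain ⟨r, hr, hr'⟩ := t.exists_max_image f ⟨l, hl⟩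
  have hlr : l ≠ r := by
    rintro rfl
    have : t.card ≤ 1 := Finset.card_le_one.2 fun a ha b hb => by
      apply hf ha hb
      linarith [hl' a ha, hl' b hb, hr' a ha, hr' b hb]
    omega
  have hsub : ({l, r} : Finset Pt) ⊆ t := by
    simp [Finset.insert_subset_iff, hl, hr]
  obtain ⟨m, hm⟩ : ∃ m, t \ {l, r} = {m} := by
    rw [← Finset.card_eq_one, Finset.card_sdiff_of_subset hsub, ht, Finset.card_pair hlr]
  have hmt : m ∈ t \ {l, r} := by rw [hm]; simp
  simp only [Finset.mem_sdiff, Finset.mem_insert, Finset.mem_singleton, not_or] at hmt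
  refine ⟨l, m, r, ?_, lt_of_le_of_ne (hl' m hmt.1) fun h => hmt.2.1 (hf hl hmt.1 h).symm,
    lt_of_le_of_ne (hr' m hmt.1) fun h => hmt.2.2 (hf hmt.1 hr h)⟩
  rw [← Finset.sdiff_union_of_subset hsub, hm]
  ext z
  simp only [Finset.mem_union, Finset.mem_insert, Finset.mem_singleton]
  tauto

/-- How far an affine function at `m` is from its interpolation between `l` and `r`. -/
lemma aff_interpolate (h : ℝ × ℝ × ℝ) (s : ℝ) (l m r : Pt) :
    ((r 0 + s * r 1) - (l 0 + s * l 1)) * aff h m =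
      ((r 0 + s * r 1) - (m 0 + s * m 1)) * aff h l +
        ((m 0 + s * m 1) - (l 0 + s * l 1)) * aff h r +
        (h.2.1 - s * h.1) * orient l r m := by
  unfold aff orient; ring

/-- Two separated triangles with a common middle vertex lie on different sides of it. -/
lemma Separated.orient_mul_neg {s : ℝ} {l m r l' r' : Pt}
    (hsep : Separated {l, m, r} {l', m, r'})
    (h₁ : l 0 + s * l 1 < m 0 + s * m 1) (h₂ : m 0 + s * m 1 < r 0 + s * r 1)
    (h₁' : l' 0 + s * l' 1 < m 0 + s * m 1) (h₂' : m 0 + s * m 1 < r' 0 + s * r' 1) :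
    orient l r m * orient l' r' m ≤ 0 := by
  obtain ⟨h, h0, ht, hs⟩ := hsep
  have hm : aff h m = 0 := le_antisymm (hs m (by simp)) (ht m (by simp))
  have hl := ht l (by simp)
  have hr := ht r (by simp)
  have hl' := hs l' (by simp)
  have hr' := hs r' (by simp)
  have e := aff_interpolate h s l m r
  have e' := aff_interpolate h s l' m r'
  rw [hm, mul_zero] at e e'
  have k : (h.2.1 - s * h.1) * orient l r m ≤ 0 := by
    nlinarith [mul_nonneg (sub_nonneg.2 h₂.le) hl, mul_nonneg (sub_nonneg.2 h₁.le) hr]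
  have k' : 0 ≤ (h.2.1 - s * h.1) * orient l' r' m := by
    nlinarith [mul_nonneg (sub_nonneg.2 h₂'.le) (neg_nonneg.2 hl'),
      mul_nonneg (sub_nonneg.2 h₁'.le) (neg_nonneg.2 hr')]
  have hne : h.2.1 - s * h.1 ≠ 0 := by
    intro hz
    have a1 : aff h l = h.1 * ((l 0 + s * l 1) - (m 0 + s * m 1)) := by
      unfold aff at *
      linear_combination hm + (l 1 - m 1) * hz
    have a2 : aff h r = h.1 * ((r 0 + s * r 1) - (m 0 + s * m 1)) := by
      unfold aff at *
      linear_combination hm + (r 1 - m 1) * hz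
    have a3 : h.1 = 0 := by
      apply le_antisymm
      · by_contra! hp
        nlinarith
      · by_contra! hp
        nlinarith
    rw [a3] at hz
    rcases h0 with h0 | h0
    · exact h0 a3
    · exact h0 (by linarith)
  have hsq : 0 < (h.2.1 - s * h.1) * (h.2.1 - s * h.1) := mul_self_pos.2 hne
  by_contra! hpos
  have : (h.2.1 - s * h.1) * (h.2.1 - s * h.1) * (orient l r m * orient l' r' m) ≤ 0 := by
    have := mul_nonpos_of_nonpos_of_nonneg k k'
    linarith
  nlinarith [mul_pos hsq hpos]

/-- Pairwise separated triangles on `n` points: there are at most `2 n - 5` of them. -/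
lemma card_add_five_le_of_separated {P : Finset Pt} (hP : GenPos (P : Set Pt)) (hn : 3 ≤ P.card)
    (D : Finset (Finset Pt)) (hD : ∀ t ∈ D, t.card = 3 ∧ t ⊆ P)
    (hsep : ∀ t ∈ D, ∀ t' ∈ D, t ≠ t' → Separated t t') : D.card + 5 ≤ 2 * P.card := by
  obtain ⟨s, hs⟩ := exists_injOn_shear P
  set X : Pt → ℝ := fun y => y 0 + s * y 1 with hX
  have hne : P.Nonempty := Finset.card_pos.1 (by omega)
  have hor : ∀ {x y z}, x ∈ P → y ∈ P → z ∈ P → X x ≠ X y → X x ≠ X z → X y ≠ X z →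
      orient x y z ≠ 0 := fun hx hy hz h1 h2 h3 =>
    hP.orient_ne_zero hx hy hz (fun h => h1 (h ▸ rfl)) (fun h => h2 (h ▸ rfl))
      (fun h => h3 (h ▸ rfl))
  have hsort : ∀ t ∈ D, ∃ l m r, t = {l, m, r} ∧ X l < X m ∧ X m < X r := fun t ht =>
    exists_sorted (hD t ht).1 fun x hx y hy h => hs x ((hD t ht).2 hx) y ((hD t ht).2 hy) h
  choose! l m r hlmr using hsort
  have hmem : ∀ t ∈ D, l t ∈ P ∧ m t ∈ P ∧ r t ∈ P := by
    intro t ht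
    have h1 := (hD t ht).2
    rw [(hlmr t ht).1] at h1
    exact ⟨h1 (by simp), h1 (by simp), h1 (by simp)⟩
  -- the leftmost and rightmost points, and a third point farthest from the line joining them
  obtain ⟨L, hL, hL'⟩ := P.exists_min_image X hne
  obtain ⟨R, hR, hR'⟩ := P.exists_max_image X hne
  have hLR : L ≠ R := by
    rintro rfl
    have : P.card ≤ 1 := Finset.card_le_one.2 fun a ha b hb => by
      apply hs a ha b hb
      change X a = X b
      linarith [hL' a ha, hL' b hb, hR' a ha, hR' b hb]
    omega
  have hXLR : X L < X R := lt_of_le_of_ne (hL' R hR) fun h => hLR (hs L hL R hR h)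
  have hcard : (P \ {L, R}).card + 2 = P.card := by
    rw [← Finset.card_pair hLR]
    exact Finset.card_sdiff_add_card_eq_card (by simp [Finset.insert_subset_iff, hL, hR])
  obtain ⟨p, hp, hpmax⟩ := (P \ {L, R}).exists_max_image (fun y => |orient L R y|)
    (Finset.card_pos.1 (by omega))
  have hpmax' : ∀ y ∈ P, |orient L R y| ≤ |orient L R p| := by
    intro y hy
    by_cases hyLR : y = L ∨ y = R
    · have : orient L R y = 0 := by rcases hyLR with rfl | rfl <;> unfold orient <;> ring
      rw [this, abs_zero]
      exact abs_nonneg _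
    · exact hpmax y (by simp only [Finset.mem_sdiff, Finset.mem_insert,
        Finset.mem_singleton]; exact ⟨hy, hyLR⟩)
  set slot : Finset Pt → Pt × Bool := fun t => (m t, decide (0 < orient (l t) (r t) (m t)))
    with hslot
  have hinj : InjOn slot D := by
    intro t ht t' ht' h
    by_contra hne'
    simp only [hslot, Prod.mk.injEq, decide_eq_decide] at h
    obtain ⟨ht1, ht2, ht3⟩ := hlmr t ht
    obtain ⟨ht1', ht2', ht3'⟩ := hlmr t' ht'
    have hsp := hsep t ht t' ht' hne'
    obtain ⟨q1, q2, q3⟩ := hmem t ht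
    obtain ⟨q1', q2', q3'⟩ := hmem t' ht'
    have o1 := hor q1 q3 q2 (by linarith) ht2.ne ht3.ne'
    have o2 := hor q1' q3' q2' (by linarith) ht2'.ne ht3'.ne'
    rw [ht1, ht1', ← h.1] at hsp
    rw [← h.1] at ht2' ht3' o2 h
    have hle := hsp.orient_mul_neg ht2 ht3 ht2' ht3'
    have hlt := lt_of_le_of_ne hle (mul_ne_zero o1 o2)
    rw [mul_neg_iff] at hlt
    rcases hlt with hlt | hlt
    · exact absurd (h.2.1 hlt.1) (not_lt.2 hlt.2.le)
    · exact absurd (h.2.2 hlt.2) (not_lt.2 hlt.1.le)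
  have himage : ∀ t ∈ D, slot t ∈
      ((P \ {L, R}) ×ˢ (Finset.univ : Finset Bool)).erase (p, decide (orient L R p < 0)) := by
    intro t ht
    obtain ⟨ht1, ht2, ht3⟩ := hlmr t ht
    obtain ⟨q1, q2, q3⟩ := hmem t ht
    have hmL : m t ≠ L := fun h => by
      have := hL' _ q1
      rw [← h] at this
      linarith
    have hmR : m t ≠ R := fun h => by
      have := hR' _ q3
      rw [← h] at this
      linarith
    rw [Finset.mem_erase]
    refine ⟨fun h => ?_, Finset.mk_mem_product (by simp [q2, hmL, hmR]) (Finset.mem_univ _)⟩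
    simp only [hslot, Prod.mk.injEq, decide_eq_decide] at h
    obtain ⟨hmp, hiff⟩ := h
    have o1 := hor q1 q3 q2 (by linarith) ht2.ne ht3.ne'
    rw [hmp] at ht2 ht3 o1 hiff
    have hg : ∀ y, aff (-(R 1 - L 1), R 0 - L 0, -(R 0 - L 0) * L 1 + (R 1 - L 1) * L 0) y =
        orient L R y := by
      intro y
      unfold aff orient
      ring
    have e := aff_interpolate
      (-(R 1 - L 1), R 0 - L 0, -(R 0 - L 0) * L 1 + (R 1 - L 1) * L 0) s (l t) p (r t)
    rw [hg, hg, hg] at e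
    have e : (X (r t) - X (l t)) * orient L R p = (X (r t) - X p) * orient L R (l t) +
        (X p - X (l t)) * orient L R (r t) + (X R - X L) * orient (l t) (r t) p := by
      simp only [hX]
      linear_combination e
    have hl := abs_le.1 (hpmax' _ q1)
    have hr := abs_le.1 (hpmax' _ q3)
    have w1 := sub_pos.2 ht3
    have w2 := sub_pos.2 ht2
    have w3 := sub_pos.2 hXLR
    simp only [Finset.mem_sdiff, Finset.mem_insert, Finset.mem_singleton, not_or] at hp
    have hp0 : orient L R p ≠ 0 := hP.orient_ne_zero hL hR hp.1 hLR (Ne.symm hp.2.1)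
      (Ne.symm hp.2.2)
    rcases lt_or_gt_of_ne hp0 with hneg | hpos
    · rw [abs_of_neg hneg] at hl hr
      have := mul_pos w3 (hiff.2 hneg)
      nlinarith [mul_nonneg w1.le (sub_nonneg.2 hl.1), mul_nonneg w2.le (sub_nonneg.2 hr.1)]
    · rw [abs_of_pos hpos] at hl hr
      have : orient (l t) (r t) p < 0 :=
        lt_of_le_of_ne (not_lt.1 fun h => absurd (hiff.1 h) (not_lt.2 hpos.le)) o1
      have := mul_neg_of_pos_of_neg w3 this
      nlinarith [mul_nonneg w1.le (sub_nonneg.2 hl.2), mul_nonneg w2.le (sub_nonneg.2 hr.2)]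
  have hle := Finset.card_le_card_of_injOn slot himage hinj
  rw [Finset.card_erase_of_mem (Finset.mk_mem_product hp (Finset.mem_univ _)),
    Finset.card_product, Finset.card_univ, Fintype.card_bool] at hle
  omega

lemma finite_flipLabels {P : Set Pt} (hfin : P.Finite) : (flipLabels P).Finite := by
  refine (Finset.finite_toSet (hfin.toFinset.powerset ×ˢ hfin.toFinset.powerset)).subset ?_
  rintro φ ⟨a, b, c, d, hF, rfl⟩
  obtain ⟨ha, hb, hc, hd⟩ := hF.1
  simp [Set.insert_subset_iff, ha, hb, hc, hd]

lemma ncard_flipLabels_le {P : Set Pt} (hfin : P.Finite) (hP : GenPos P) (hn : 3 ≤ P.ncard) :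
    (flipLabels P).ncard ≤ P.ncard - 3 := by
  classical
  rw [Set.ncard_eq_toFinset_card P hfin] at hn ⊢
  rw [Set.ncard_eq_toFinset_card _ (finite_flipLabels hfin)]
  set D := hfin.toFinset.powerset.filter (EmptyTri P) with hD
  have hD' : ∀ t ∈ D, t ⊆ hfin.toFinset ∧ EmptyTri P t := by
    intro t ht
    simpa [hD] using ht
  have hcount := card_add_five_le_of_separated (P := hfin.toFinset) (by simpa using hP) hn D
    (fun t ht => ⟨(hD' t ht).2.1, (hD' t ht).1⟩)
    (fun t ht t' ht' hne => (hD' t ht).2.separated hP (hD' t' ht').2 hne)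
  have hdouble := Finset.card_mul_le_card_mul (s := (finite_flipLabels hfin).toFinset) (t := D)
    (m := 2) (n := 1) (fun φ t => ∃ c ∈ φ.2, insert c φ.1 = t) ?_ ?_
  · omega
  · intro φ hφ
    obtain ⟨a, b, c, d, hF, rfl⟩ := (finite_flipLabels hfin).mem_toFinset.1 hφ
    have ne := hF.2.1.ne
    have hcd : (insert c {a, b} : Finset Pt) ≠ insert d {a, b} := by
      intro h
      have : c ∈ (insert d {a, b} : Finset Pt) := h ▸ Finset.mem_insert_self _ _
      simp only [Finset.mem_insert, Finset.mem_singleton] at this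
      rcases this with h | h | h
      · exact ne.2.2.2.2.2 h
      · exact ne.2.1 h.symm
      · exact ne.2.2.2.1 h.symm
    have hmemD : ∀ t, EmptyTri P t → t ∈ D := by
      intro t ht
      refine Finset.mem_filter.2 ⟨Finset.mem_powerset.2 fun x hx => ?_, ht⟩
      exact hfin.mem_toFinset.2 (ht.2.1 hx)
    rw [← Finset.card_pair hcd]
    refine Finset.card_le_card ?_
    intro t ht
    rw [Finset.mem_bipartiteAbove]
    simp only [Finset.mem_insert, Finset.mem_singleton] at ht
    rcases ht with rfl | rfl
    · exact ⟨hmemD _ hF.emptyTri, c, by simp, rfl⟩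
    · exact ⟨hmemD _ hF.swap_right.emptyTri, d, by simp, rfl⟩
  · intro t ht
    refine Finset.card_le_one.2 fun φ hφ φ' hφ' => ?_
    rw [Finset.mem_bipartiteBelow, (finite_flipLabels hfin).mem_toFinset] at hφ hφ'
    obtain ⟨hφ, c, hc, hct⟩ := hφ
    obtain ⟨hφ', c', hc', hct'⟩ := hφ'
    exact flipLabels_unique hP hφ hφ' hc hc' (hct.trans hct'.symm)

/-- Lemma 3.2 (upper bound): every set of `n ≥ 3` points in general position has at most
`2 ^ (n - 3)` order-1 Delaunay triangulations. -/
theorem order_one_triangulations_le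
    (P : Set Pt) (hfin : P.Finite) (hgp : GenPos P)
    (n : ℕ) (hn : 3 ≤ n) (hcard : P.ncard = n) :
    {T : Set (Finset Pt) | IsOrderDT P 1 T}.ncard ≤ 2 ^ (n - 3) := by
  subst hcard
  have hΦ := finite_flipLabels hfin
  calc {T : Set (Finset Pt) | IsOrderDT P 1 T}.ncard
      ≤ (𝒫 (flipLabels P)).ncard :=
        Set.ncard_le_ncard_of_injOn (flipsOf P) (fun _ _ => sep_subset _ _)
          (flipsOf_injOn hgp) hΦ.powerset
    _ = 2 ^ (flipLabels P).ncard := Set.ncard_powerset _ hΦ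
    _ ≤ 2 ^ (P.ncard - 3) :=
        Nat.pow_le_pow_right (by norm_num) (ncard_flipLabels_le hfin hgp hn)

end
end
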